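/- arXiv:0705.3820 — 2 statements merged into one kernel-verified Lean document; each statement's English description precedes it below -/
import Mathlib

section
/- Every finite set S of points in convex position in general position in the plane admits a spanning path that is 3π/2-open, i.e., a Hamiltonian non-crossing path in which every vertex has an incident angle of at least 3π/2 (equivalently, every interior vertex of the path has its two incident edges spanning an angle at most π/2 on one side). -/
open scoped Classical
open EuclideanGeometry

noncomputable section

abbrev Pt := EuclideanSpace ℝ (Fin 2)

/-- No three points of `S` are collinear. -/
def GenPos (S : Finset Pt) : Prop :=
  ∀ p ∈ S, ∀ q ∈ S, ∀ r ∈ S, p ≠ q → p ≠ r → q ≠ r →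
    ¬ Collinear ℝ ({p, q, r} : Set Pt)

/-- A plane straight-line graph on the finite point set `S`: vertices are points of `S`,
edges are recorded as ordered pairs closed under swapping, and two edges that are not
the same unordered pair may only meet at common endpoints. -/
structure PSLG (S : Finset Pt) where
  E : Finset (Pt × Pt)
  symm : ∀ e ∈ E, (e.2, e.1) ∈ E
  endpts : ∀ e ∈ E, e.1 ∈ S ∧ e.2 ∈ S
  ne : ∀ e ∈ E, e.1 ≠ e.2
  noncross : ∀ e ∈ E, ∀ f ∈ E, e ≠ f → e ≠ (f.2, f.1) →
    ∀ x, x ∈ segment ℝ e.1 e.2 → x ∈ segment ℝ f.1 f.2 →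
      (x = e.1 ∨ x = e.2) ∧ (x = f.1 ∨ x = f.2)

/-- The degree of the point `p` in `G`. -/
def PSLG.deg {S : Finset Pt} (G : PSLG S) (p : Pt) : ℕ :=
  (G.E.filter fun e => e.1 = p).card

/-- The point `p` has an incident angle of size at least `φ` in `G`: all edge directions
at `p` fit in a closed cone of half-angle `π - φ / 2` (for `p` of degree ≤ 1 the maximum
incident angle is `2π`, and this condition holds trivially). -/
def VertexOpen {S : Finset Pt} (G : PSLG S) (p : Pt) (φ : ℝ) : Prop :=
  ∃ d : Pt, d ≠ 0 ∧ ∀ q : Pt, (p, q) ∈ G.E →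
    InnerProductGeometry.angle d (q - p) ≤ Real.pi - φ / 2

/-- `G` is `φ`-open: every vertex has an incident angle of size at least `φ`. -/
def PSLG.IsPhiOpen {S : Finset Pt} (G : PSLG S) (φ : ℝ) : Prop :=
  ∀ p ∈ S, VertexOpen G p φ

/-- `G` is connected on `S`. -/
def PSLG.Connected {S : Finset Pt} (G : PSLG S) : Prop :=
  ∀ p ∈ S, ∀ q ∈ S, Relation.ReflTransGen (fun a b => (a, b) ∈ G.E) p q

/-- `G` is a spanning tree of `S`: connected and with the minimum possible number of
edges (each undirected edge is recorded twice). -/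
def PSLG.IsSpanningTree {S : Finset Pt} (G : PSLG S) : Prop :=
  G.Connected ∧ G.E.card = 2 * (S.card - 1)

/-- `G` is a (non-crossing Hamiltonian) spanning path of `S`: a spanning tree of maximum
vertex degree at most two. -/
def PSLG.IsSpanningPath {S : Finset Pt} (G : PSLG S) : Prop :=
  G.IsSpanningTree ∧ ∀ p ∈ S, G.deg p ≤ 2

/-- `S` is in convex position. -/
def ConvexPos (S : Finset Pt) : Prop :=
  ∀ p ∈ S, p ∉ convexHull ℝ (↑(S.erase p) : Set Pt)

/-- `G` is a triangulation of `S`: a maximal plane straight-line graph, i.e. any further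
edge between points of `S` would cross the existing graph. -/
def PSLG.IsTriangulation {S : Finset Pt} (G : PSLG S) : Prop :=
  ∀ p ∈ S, ∀ q ∈ S, p ≠ q → (p, q) ∉ G.E →
    ∃ e ∈ G.E, ∃ x, x ∈ segment ℝ p q ∧ x ∈ segment ℝ e.1 e.2 ∧
      ¬((x = p ∨ x = q) ∧ (x = e.1 ∨ x = e.2))

end

/-- Twice the signed area of the triangle `a b c`. -/
def signedArea (a b c : Pt) : ℝ :=
  (b 0 - a 0) * (c 1 - a 1) - (b 1 - a 1) * (c 0 - a 0)

lemma inner_pt (u v : Pt) : inner ℝ u v = u 0 * v 0 + u 1 * v 1 := by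
  simp [PiLp.inner_apply, Fin.sum_univ_two, mul_comm]

lemma signedArea_rotate (a b c : Pt) : signedArea b c a = signedArea a b c := by
  unfold signedArea; ring

lemma signedArea_swap (a b c : Pt) : signedArea a c b = -signedArea a b c := by
  unfold signedArea; ring

lemma signedArea_eq_zero_of_eq {a b c : Pt} (h : a = b ∨ a = c ∨ b = c) :
    signedArea a b c = 0 := by
  unfold signedArea; rcases h with rfl | rfl | rfl <;> ring

lemma collinear_of_signedArea_eq_zero {a b c : Pt} (hab : a ≠ b) (h : signedArea a b c = 0) :
    Collinear ℝ ({a, b, c} : Set Pt) := by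
  rw [collinear_iff_of_mem (p₀ := a) (by simp)]
  refine ⟨b - a, ?_⟩
  have key : ∃ r : ℝ, c = r • (b - a) + a := by
    unfold signedArea at h
    by_cases h0 : b 0 - a 0 = 0
    · have h1 : b 1 - a 1 ≠ 0 := by
        intro h1
        apply hab
        ext i
        fin_cases i
        · simpa using (sub_eq_zero.1 h0).symm
        · simpa using (sub_eq_zero.1 h1).symm
      refine ⟨(c 1 - a 1) / (b 1 - a 1), ?_⟩
      ext i
      fin_cases i
      · simp only [PiLp.add_apply, PiLp.smul_apply, PiLp.sub_apply, smul_eq_mul, Fin.zero_eta]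
        field_simp
        linarith
      · simp only [PiLp.add_apply, PiLp.smul_apply, PiLp.sub_apply, smul_eq_mul, Fin.mk_one]
        field_simp
        ring
    · refine ⟨(c 0 - a 0) / (b 0 - a 0), ?_⟩
      ext i
      fin_cases i
      · simp only [PiLp.add_apply, PiLp.smul_apply, PiLp.sub_apply, smul_eq_mul, Fin.zero_eta]
        field_simp
        ring
      · simp only [PiLp.add_apply, PiLp.smul_apply, PiLp.sub_apply, smul_eq_mul, Fin.mk_one]
        field_simp
        linarith
  intro p hp
  rcases hp with rfl | rfl | rfl
  · exact ⟨0, by simp⟩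
  · exact ⟨1, by simp⟩
  · exact key

lemma GenPos.signedArea_ne_zero {S : Finset Pt} (hgp : GenPos S) {a b c : Pt}
    (ha : a ∈ S) (hb : b ∈ S) (hc : c ∈ S) (hab : a ≠ b) (hac : a ≠ c) (hbc : b ≠ c) :
    signedArea a b c ≠ 0 :=
  fun h => hgp a ha b hb c hc hab hac hbc (collinear_of_signedArea_eq_zero hab h)

/-- A point of a set in convex position lies in no triangle spanned by the others. -/
lemma ConvexPos.not_inside {S : Finset Pt} (hcp : ConvexPos S) {a b c x : Pt}
    (ha : a ∈ S) (hb : b ∈ S) (hc : c ∈ S) (hx : x ∈ S)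
    (h1 : 0 < signedArea x b c) (h2 : 0 < signedArea x c a) (h3 : 0 < signedArea x a b) :
    False := by
  apply hcp x hx
  have hxa : a ≠ x := by rintro rfl; simp [signedArea] at h2
  have hxb : b ≠ x := by rintro rfl; simp [signedArea] at h1
  have hxc : c ≠ x := by rintro rfl; simp [signedArea] at h2
  set T := signedArea x b c + signedArea x c a + signedArea x a b with hT
  have hTpos : 0 < T := by positivity
  have hmem := (convex_convexHull ℝ (↑(S.erase x) : Set Pt)).sum_mem (t := Finset.univ)
    (w := ![signedArea x b c / T, signedArea x c a / T, signedArea x a b / T])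
    (z := ![a, b, c]) (by
      intro i _
      fin_cases i <;> simp <;> positivity) (by
      simp only [Fin.sum_univ_three, Matrix.cons_val_zero, Matrix.cons_val_one, Matrix.cons_val]
      field_simp
      rw [hT]) (by
      intro i _
      apply subset_convexHull
      fin_cases i <;> simp [*])
  convert hmem using 1
  simp only [Fin.sum_univ_three, Matrix.cons_val_zero, Matrix.cons_val_one, Matrix.cons_val]
  ext i
  have hTne := hTpos.ne'
  fin_cases i <;> simp <;> field_simp <;> rw [hT] <;> unfold signedArea <;> ring

/-- A set in convex and general position can be listed in counterclockwise order. -/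
lemma exists_ccw_order {S : Finset Pt} (hgp : GenPos S) (hcp : ConvexPos S) (hne : S.Nonempty) :
    ∃ b : Fin S.card → Pt, Function.Injective b ∧ (∀ i, b i ∈ S) ∧
      ∀ i j k, i < j → j < k → 0 < signedArea (b i) (b j) (b k) := by
  obtain ⟨o, ho⟩ := hne
  have htrans : ∀ x ∈ S, ∀ y ∈ S, ∀ z ∈ S, 0 < signedArea o x y → 0 < signedArea o y z →
      0 < signedArea o x z := by
    intro x hx y hy z hz hxy hyz
    have hox : o ≠ x := by rintro rfl; simp [signedArea] at hxy
    have hoz : o ≠ z := by rintro rfl; simp [signedArea] at hyz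
    have hxz : x ≠ z := by
      rintro rfl
      rw [signedArea_swap] at hxy
      linarith
    by_contra hcon
    have hne := hgp.signedArea_ne_zero ho hx hz hox hoz hxz
    have hlt : signedArea o x z < 0 := lt_of_le_of_ne (not_lt.1 hcon) hne
    exact hcp.not_inside hx hy hz ho hyz (by rw [signedArea_swap]; linarith) hxy
  let L : LinearOrder {x // x ∈ S} :=
    { le := fun x y => x = y ∨ x.1 = o ∨ 0 < signedArea o x y
      le_refl := fun x => Or.inl rfl
      le_trans := by
        rintro x y z (rfl | h | h) (rfl | h' | h')
        · exact Or.inl rfl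
        · exact Or.inr (Or.inl h')
        · exact Or.inr (Or.inr h')
        · exact Or.inr (Or.inl h)
        · exact Or.inr (Or.inl h)
        · exact Or.inr (Or.inl h)
        · exact Or.inr (Or.inr h)
        · rw [h'] at h; simp [signedArea] at h
        · exact Or.inr (Or.inr (htrans _ x.2 _ y.2 _ z.2 h h'))
      le_antisymm := by
        rintro x y (h | h | h) (h' | h' | h')
        · exact h
        · exact h
        · exact h
        · exact h'.symm
        · exact Subtype.ext (h.trans h'.symm)
        · rw [h] at h'; simp [signedArea] at h'
        · exact h'.symm
        · rw [h'] at h; simp [signedArea] at h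
        · rw [signedArea_swap] at h; linarith
      le_total := by
        intro x y
        by_cases hxy : x = y
        · exact Or.inl (Or.inl hxy)
        by_cases hx : x.1 = o
        · exact Or.inl (Or.inr (Or.inl hx))
        by_cases hy : y.1 = o
        · exact Or.inr (Or.inr (Or.inl hy))
        have hne := hgp.signedArea_ne_zero ho x.2 y.2 (Ne.symm hx) (Ne.symm hy)
          (fun h => hxy (Subtype.ext h))
        rcases lt_or_gt_of_ne hne with h | h
        · exact Or.inr (Or.inr (Or.inr (by rw [signedArea_swap]; linarith)))
        · exact Or.inl (Or.inr (Or.inr h))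
      toDecidableLE := Classical.decRel _ }
  let f := Fintype.orderIsoFinOfCardEq {x // x ∈ S} (Fintype.card_coe S)
  have hlt : ∀ i j, i < j → (f i).1 = o ∨ 0 < signedArea o (f i) (f j) := by
    intro i j hij
    rcases (f.strictMono hij).le with h | h
    · exact absurd (f.injective h) hij.ne
    · exact h
  have hinj : ∀ i j, i < j → (f i).1 ≠ (f j).1 :=
    fun i j hij h => hij.ne (f.injective (Subtype.ext h))
  have hno : ∀ i j, i < j → (f j).1 ≠ o := by
    intro i j hij h
    rcases hlt i j hij with h' | h'
    · exact hinj i j hij (h'.trans h.symm)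
    · rw [h] at h'; simp [signedArea] at h'
  refine ⟨fun i => (f i).1, fun i j h => f.injective (Subtype.ext h), fun i => (f i).2, ?_⟩
  intro i j k hij hjk
  have hjk' := (hlt j k hjk).resolve_left (hno i j hij)
  rcases hlt i j hij with h | h
  · simpa only [h] using hjk'
  · by_cases hio : (f i).1 = o
    · simpa only [hio] using hjk'
    have hik' := (hlt i k (hij.trans hjk)).resolve_left hio
    by_contra hcon
    have hne := hgp.signedArea_ne_zero (f i).2 (f j).2 (f k).2 (hinj _ _ hij)
      (hinj _ _ (hij.trans hjk)) (hinj _ _ hjk)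
    have hneg := lt_of_le_of_ne (not_lt.1 hcon) hne
    refine hcp.not_inside ho (f i).2 (f k).2 (f j).2 (x := f j) ?_ ?_ ?_
    · rw [signedArea_swap, signedArea_rotate, signedArea_swap, signedArea_rotate] at *
      unfold signedArea at *; linarith
    · rw [signedArea_rotate]; exact hjk'
    · rw [← signedArea_rotate]; exact h

/-- A periodic counterclockwise enumeration of the vertices of a convex polygon. -/
structure CcwCycle (S : Finset Pt) (p : ℤ → Pt) : Prop where
  periodic : ∀ i a : ℤ, p (i + a * S.card) = p i
  mem : ∀ i, p i ∈ S
  ne : ∀ i j : ℤ, i < j → j < i + S.card → p i ≠ p j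
  ccw : ∀ i j k : ℤ, i < j → j < k → k < i + S.card → 0 < signedArea (p i) (p j) (p k)

lemma exists_ccwCycle {S : Finset Pt} (hgp : GenPos S) (hcp : ConvexPos S) (hne : S.Nonempty) :
    ∃ p, CcwCycle S p := by
  obtain ⟨b, hinj, hmem, hccw⟩ := exists_ccw_order hgp hcp hne
  have hpos : (0 : ℤ) < S.card := by exact_mod_cast hne.card_pos
  let red : ℤ → Fin S.card := fun i =>
    ⟨(i % S.card).toNat, by
      have := Int.emod_nonneg i hpos.ne'
      have := Int.emod_lt_of_pos i hpos
      omega⟩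
  have hred : ∀ i, ((red i : ℕ) : ℤ) = i % S.card := fun i =>
    Int.toNat_of_nonneg (Int.emod_nonneg i hpos.ne')
  have hper : ∀ i a, red (i + a * S.card) = red i := by
    intro i a
    apply Fin.ext
    have h1 := hred (i + a * S.card)
    rw [Int.add_mul_emod_self_right, ← hred] at h1
    exact_mod_cast h1
  have hsmall : ∀ i : ℤ, 0 ≤ i → i < S.card → ((red i : ℕ) : ℤ) = i := fun i h0 h1 => by
    rw [hred, Int.emod_eq_of_lt h0 h1]
  have hlarge : ∀ i : ℤ, (S.card : ℤ) ≤ i → i < 2 * S.card →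
      ((red i : ℕ) : ℤ) = i - S.card := fun i h0 h1 => by
    rw [← hsmall (i - S.card) (by omega) (by omega), ← hper (i - S.card) 1]
    simp
  have hshift : ∀ i : ℤ, ∃ a : ℤ, 0 ≤ i + a * S.card ∧ i + a * S.card < S.card := by
    intro i
    refine ⟨-(i / S.card), ?_, ?_⟩
    · have := Int.emod_nonneg i hpos.ne'
      rw [Int.emod_def] at this
      linarith
    · have := Int.emod_lt_of_pos i hpos
      rw [Int.emod_def] at this
      linarith
  refine ⟨fun i => b (red i), fun i a => congrArg b (hper i a), fun i => hmem _, ?_, ?_⟩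
  · intro i j hij hj
    obtain ⟨a, h0, h1⟩ := hshift i
    rw [← hper i a, ← hper j a]
    intro h
    have h := congrArg (fun x : Fin S.card => ((x : ℕ) : ℤ)) (hinj h)
    rw [hsmall _ h0 h1] at h
    rcases lt_or_ge (j + a * S.card) S.card with hc | hc
    · rw [hsmall _ (by omega) hc] at h
      omega
    · rw [hlarge _ hc (by omega)] at h
      omega
  · intro i j k hij hjk hk
    obtain ⟨a, h0, h1⟩ := hshift i
    rw [← hper i a, ← hper j a, ← hper k a]
    have hi := hsmall _ h0 h1
    rcases lt_or_ge (k + a * S.card) S.card with hkc | hkc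
    · have hj' := hsmall (j + a * S.card) (by omega) (by omega)
      have hk' := hsmall (k + a * S.card) (by omega) (by omega)
      apply hccw <;> rw [Fin.lt_def] <;> omega
    have hk' := hlarge (k + a * S.card) hkc (by omega)
    rcases lt_or_ge (j + a * S.card) S.card with hjc | hjc
    · have hj' := hsmall (j + a * S.card) (by omega) (by omega)
      rw [← signedArea_rotate, ← signedArea_rotate]
      apply hccw <;> rw [Fin.lt_def] <;> omega
    · have hj' := hlarge (j + a * S.card) hjc (by omega)
      rw [← signedArea_rotate]
      apply hccw <;> rw [Fin.lt_def] <;> omega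

/-- In a cone narrower than a half plane, widening an obtuse angle on the far side keeps it
obtuse. -/
lemma inner_neg_widen_right {o u v w : Pt} (huv : 0 < signedArea o u v)
    (hvw : 0 < signedArea o v w) (huw : 0 < signedArea o u w)
    (h : inner ℝ (u - o) (v - o) < 0) : inner ℝ (u - o) (w - o) < 0 := by
  simp only [inner_pt, PiLp.sub_apply] at *
  have hid : signedArea o u v * ((u 0 - o 0) * (w 0 - o 0) + (u 1 - o 1) * (w 1 - o 1)) =
      -(signedArea o v w * ((u 0 - o 0) ^ 2 + (u 1 - o 1) ^ 2)) +
        signedArea o u w * ((u 0 - o 0) * (v 0 - o 0) + (u 1 - o 1) * (v 1 - o 1)) := by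
    unfold signedArea; ring
  have h1 : 0 ≤ signedArea o v w * ((u 0 - o 0) ^ 2 + (u 1 - o 1) ^ 2) := by positivity
  have h2 := mul_neg_of_pos_of_neg huw h
  by_contra hcon
  have := mul_nonneg huv.le (not_lt.1 hcon)
  linarith

lemma inner_neg_widen_left {o u v w : Pt} (huv : 0 < signedArea o u v)
    (hvw : 0 < signedArea o v w) (huw : 0 < signedArea o u w)
    (h : inner ℝ (v - o) (w - o) < 0) : inner ℝ (u - o) (w - o) < 0 := by
  simp only [inner_pt, PiLp.sub_apply] at *
  have hid : signedArea o v w * ((u 0 - o 0) * (w 0 - o 0) + (u 1 - o 1) * (w 1 - o 1)) =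
      -(signedArea o u v * ((w 0 - o 0) ^ 2 + (w 1 - o 1) ^ 2)) +
        signedArea o u w * ((v 0 - o 0) * (w 0 - o 0) + (v 1 - o 1) * (w 1 - o 1)) := by
    unfold signedArea; ring
  have h1 : 0 ≤ signedArea o u v * ((w 0 - o 0) ^ 2 + (w 1 - o 1) ^ 2) := by positivity
  have h2 := mul_neg_of_pos_of_neg huw h
  by_contra hcon
  have := mul_nonneg hvw.le (not_lt.1 hcon)
  linarith

/-- Two consecutive obtuse angles do not fit in a half plane. -/
lemma not_two_obtuse {o u v w : Pt} (huv : 0 < signedArea o u v)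
    (hvw : 0 < signedArea o v w) (huw : 0 < signedArea o u w)
    (h1 : inner ℝ (u - o) (v - o) < 0) (h2 : inner ℝ (v - o) (w - o) < 0) : False := by
  simp only [inner_pt, PiLp.sub_apply] at *
  have hid : ((v 0 - o 0) ^ 2 + (v 1 - o 1) ^ 2) * signedArea o u w =
      signedArea o u v * ((v 0 - o 0) * (w 0 - o 0) + (v 1 - o 1) * (w 1 - o 1)) +
        ((u 0 - o 0) * (v 0 - o 0) + (u 1 - o 1) * (v 1 - o 1)) * signedArea o v w := by
    unfold signedArea; ring
  have h3 := mul_neg_of_pos_of_neg huv h2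
  have h4 := mul_neg_of_neg_of_pos h1 hvw
  have h5 : 0 ≤ ((v 0 - o 0) ^ 2 + (v 1 - o 1) ^ 2) * signedArea o u w := by positivity
  linarith

namespace CcwCycle

variable {S : Finset Pt} {p : ℤ → Pt}

/-- The vertex `p j` sees the polygon edge from `p k` to `p (k + 1)` at an obtuse angle. -/
def Obtuse (S : Finset Pt) (p : ℤ → Pt) (j k : ℤ) : Prop :=
  j < k ∧ k + 1 < j + S.card ∧ inner ℝ (p k - p j) (p (k + 1) - p j) < 0

lemma Obtuse.widen (hp : CcwCycle S p) {j k a b : ℤ} (h : Obtuse S p j k)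
    (hja : j < a) (hak : a ≤ k) (hkb : k + 1 ≤ b) (hb : b < j + S.card) :
    inner ℝ (p a - p j) (p b - p j) < 0 := by
  obtain ⟨h1, h2, h3⟩ := h
  have hkb' : inner ℝ (p k - p j) (p b - p j) < 0 := by
    rcases hkb.eq_or_lt with rfl | hlt
    · exact h3
    · exact inner_neg_widen_right (hp.ccw j k (k + 1) (by omega) (by omega) (by omega))
        (hp.ccw j (k + 1) b (by omega) (by omega) (by omega))
        (hp.ccw j k b (by omega) (by omega) (by omega)) h3
  rcases hak.eq_or_lt with rfl | hlt
  · exact hkb'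
  · exact inner_neg_widen_left (hp.ccw j a k (by omega) (by omega) (by omega))
      (hp.ccw j k b (by omega) (by omega) (by omega))
      (hp.ccw j a b (by omega) (by omega) (by omega)) hkb'

lemma Obtuse.not_lt (hp : CcwCycle S p) {j k l : ℤ} (h : Obtuse S p j k) (h' : Obtuse S p j l) :
    ¬ k < l := by
  intro hkl
  have hk := h.1
  have hl := h'.2.1
  exact not_two_obtuse (hp.ccw j k l (by omega) (by omega) (by omega))
    (hp.ccw j l (l + 1) (by omega) (by omega) (by omega))
    (hp.ccw j k (l + 1) (by omega) (by omega) (by omega))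
    (h.widen hp h.1 le_rfl (by omega) (by omega)) h'.2.2

lemma Obtuse.unique (hp : CcwCycle S p) {j k l : ℤ} (h : Obtuse S p j k) (h' : Obtuse S p j l) :
    k = l :=
  le_antisymm (_root_.not_lt.1 (h'.not_lt hp h)) (_root_.not_lt.1 (h.not_lt hp h'))

lemma Obtuse.antitone (hp : CcwCycle S p) {j k m : ℤ} (h : Obtuse S p j k)
    (h' : Obtuse S p (j + 1) m) : m ≤ k := by
  by_contra hcon
  have hk := h.1
  have hm := h'.1
  have hm' := h'.2.1
  have h1 := h.widen hp (a := j + 1) (b := m) (by omega) (by omega) (by omega) (by omega)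
  have h2 := h'.widen hp (a := m) (b := j + 1 * S.card) (by omega) (by omega) (by omega) (by omega)
  rw [hp.periodic] at h2
  have h3 : inner ℝ (p m - p (j + 1)) (p j - p (j + 1)) =
      inner ℝ (p (j + 1) - p j) (p (j + 1) - p j) - inner ℝ (p (j + 1) - p j) (p m - p j) := by
    simp only [inner_pt, PiLp.sub_apply]; ring
  have h4 : 0 ≤ inner ℝ (p (j + 1) - p j) (p (j + 1) - p j) := real_inner_self_nonneg
  linarith

lemma Obtuse.shift (hp : CcwCycle S p) {j k : ℤ} (h : Obtuse S p j k) (a : ℤ) :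
    Obtuse S p (j + a * S.card) (k + a * S.card) := by
  refine ⟨by linarith [h.1], by linarith [h.2.1], ?_⟩
  rw [add_right_comm, hp.periodic, hp.periodic, hp.periodic]
  exact h.2.2

/-- Some vertex of a convex polygon sees no edge at an obtuse angle. -/
lemma exists_forall_not_obtuse (hp : CcwCycle S p) : ∃ j, ∀ k, ¬ Obtuse S p j k := by
  by_contra! hcon
  choose F hF using hcon
  have hle : ∀ t : ℕ, F t ≤ F 0 := by
    intro t
    induction t with
    | zero => simp
    | succ t ih =>
      have := (hF t).antitone hp (by simpa using hF (t + 1 : ℕ))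
      exact this.trans ih
  have h0 := (hF 0).2.1
  have hn := (hF S.card).1
  have := hle S.card
  omega

/-- Some residue class of `j + k` contains no pair where `p j` sees the edge at `k` at an obtuse
angle. -/
lemma exists_residue (hp : CcwCycle S p) (hne : S.Nonempty) :
    ∃ c : ℤ, ∀ j k, (S.card : ℤ) ∣ j + k - c → ¬ Obtuse S p j k := by
  have hpos : (0 : ℤ) < S.card := by exact_mod_cast hne.card_pos
  have hn := hpos.ne'
  obtain ⟨j₀, hj₀⟩ := hp.exists_forall_not_obtuse
  by_contra! hcon
  choose J K hdvd hob using hcon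
  have hmaps : ∀ c ∈ Finset.range S.card, (J c) % (S.card : ℤ) ∈
      (Finset.Ico (0 : ℤ) S.card).erase (j₀ % S.card) := by
    intro c _
    rw [Finset.mem_erase, Finset.mem_Ico]
    refine ⟨fun h => ?_, Int.emod_nonneg _ hn, Int.emod_lt_of_pos _ hpos⟩
    obtain ⟨a, ha⟩ := Int.ModEq.dvd h.symm
    apply hj₀ (K c + (-a) * S.card)
    have := (hob c).shift hp (-a)
    rwa [show J c + -a * (S.card : ℤ) = j₀ by linarith] at this
  have hcard : ((Finset.Ico (0 : ℤ) S.card).erase (j₀ % S.card)).card <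
      (Finset.range S.card).card := by
    rw [Finset.card_erase_of_mem (by
      rw [Finset.mem_Ico]
      exact ⟨Int.emod_nonneg _ hn, Int.emod_lt_of_pos _ hpos⟩)]
    simp
    omega
  obtain ⟨c, hc, d, hd, hcd, h⟩ := Finset.exists_ne_map_eq_of_card_lt_of_maps_to hcard hmaps
  obtain ⟨a, ha⟩ := Int.ModEq.dvd h.symm
  have hs := (hob d).shift hp a
  rw [show J d + a * (S.card : ℤ) = J c by linarith] at hs
  have hK := (hob c).unique hp hs
  obtain ⟨x, hx⟩ := hdvd c
  obtain ⟨y, hy⟩ := hdvd d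
  apply hcd
  rw [Finset.mem_range] at hc hd
  have h1 : (c : ℤ) - d = S.card * (2 * a + y - x) := by linarith
  have h2 : (c : ℤ) - d = 0 := by
    apply Int.eq_zero_of_abs_lt_dvd (Dvd.intro _ h1.symm)
    rw [abs_lt]
    constructor <;> omega
  omega

end CcwCycle

/-- Two nonzero vectors at an angle of at most `π / 2` lie in a cone of half-angle `π / 4`. -/
lemma exists_angle_le_quarter {a b : Pt} (ha : a ≠ 0) (hb : b ≠ 0) (h : 0 ≤ inner ℝ a b) :
    ∃ d : Pt, d ≠ 0 ∧ InnerProductGeometry.angle d a ≤ Real.pi / 4 ∧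
      InnerProductGeometry.angle d b ≤ Real.pi / 4 := by
  have ha' := norm_pos_iff.2 ha
  have hb' := norm_pos_iff.2 hb
  have key : ∀ u w : Pt, ‖u‖ = 1 → ‖w‖ = 1 → 0 ≤ inner ℝ u w →
      InnerProductGeometry.angle (u + w) u ≤ Real.pi / 4 := by
    intro u w hu hw huw
    have hsq : ‖u + w‖ ^ 2 = 2 * (1 + inner ℝ u w) := by
      rw [norm_add_sq_real, hu, hw]; ring
    have hpos : 0 < ‖u + w‖ := by
      by_contra hcon
      have : ‖u + w‖ = 0 := le_antisymm (not_lt.1 hcon) (norm_nonneg _)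
      rw [this] at hsq
      linarith
    have hin : inner ℝ (u + w) u = 1 + inner ℝ u w := by
      rw [inner_add_left, real_inner_self_eq_norm_sq, hu, real_inner_comm]; ring
    unfold InnerProductGeometry.angle
    rw [← Real.arccos_cos (x := Real.pi / 4) (by positivity) (by linarith [Real.pi_pos])]
    apply Real.arccos_le_arccos
    rw [Real.cos_pi_div_four, hin, hu, mul_one, le_div_iff₀ hpos,
      ← abs_of_nonneg (a := Real.sqrt 2 / 2 * ‖u + w‖) (by positivity)]
    apply abs_le_of_sq_le_sq _ (by linarith)
    rw [mul_pow, hsq, div_pow, Real.sq_sqrt (by norm_num)]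
    nlinarith
  set u := ‖a‖⁻¹ • a with hu
  set w := ‖b‖⁻¹ • b with hw
  have hu1 : ‖u‖ = 1 := norm_smul_inv_norm ha
  have hw1 : ‖w‖ = 1 := norm_smul_inv_norm hb
  have huw : 0 ≤ inner ℝ u w := by
    rw [hu, hw, real_inner_smul_left, real_inner_smul_right]
    positivity
  have hua : InnerProductGeometry.angle (u + w) a ≤ Real.pi / 4 := by
    rw [← InnerProductGeometry.angle_smul_right_of_pos _ a (inv_pos.2 ha')]
    exact key u w hu1 hw1 huw
  have hwb : InnerProductGeometry.angle (u + w) b ≤ Real.pi / 4 := by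
    rw [← InnerProductGeometry.angle_smul_right_of_pos _ b (inv_pos.2 hb'), add_comm]
    exact key w u hw1 hu1 (by rwa [real_inner_comm])
  refine ⟨u + w, fun h0 => ?_, hua, hwb⟩
  rw [h0, InnerProductGeometry.angle_zero_left] at hua
  linarith [Real.pi_pos]

lemma signedArea_combo (a b c d : Pt) {α β : ℝ} (h : α + β = 1) :
    signedArea a b (α • c + β • d) = α * signedArea a b c + β * signedArea a b d := by
  obtain rfl : β = 1 - α := by linarith
  simp only [signedArea, PiLp.add_apply, PiLp.smul_apply, smul_eq_mul]
  ring

/-- Consecutive edges of a path, each of whose edges has the rest of the path on one side, meet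
only at common endpoints. -/
lemma eq_of_mem_segments {v : ℕ → Pt} {n : ℕ}
    (hside : ∀ s, ∃ ε : ℝ, ∀ t, s + 1 < t → t < n → 0 < ε * signedArea (v s) (v (s + 1)) (v t))
    {s t : ℕ} (hst : s < t) (ht : t + 1 < n) {x : Pt}
    (hx : x ∈ segment ℝ (v s) (v (s + 1))) (hx' : x ∈ segment ℝ (v t) (v (t + 1))) :
    x = v (s + 1) ∧ x = v t := by
  obtain ⟨ε, hε⟩ := hside s
  obtain ⟨α, β, hα, hβ, hαβ, rfl⟩ := hx
  obtain ⟨γ, δ, hγ, hδ, hγδ, hx⟩ := hx'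
  have h0 : signedArea (v s) (v (s + 1)) (α • v s + β • v (s + 1)) = 0 := by
    rw [signedArea_combo _ _ _ _ hαβ, signedArea_eq_zero_of_eq (by simp),
      signedArea_eq_zero_of_eq (by simp)]
    ring
  rw [← hx, signedArea_combo _ _ _ _ hγδ] at h0
  have h0' : γ * (ε * signedArea (v s) (v (s + 1)) (v t)) +
      δ * (ε * signedArea (v s) (v (s + 1)) (v (t + 1))) = 0 := by linear_combination ε * h0
  have hpos := hε (t + 1) (by omega) ht
  have hδ0 : δ = 0 := by
    have h1 : 0 ≤ ε * signedArea (v s) (v (s + 1)) (v t) := by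
      rcases (Nat.succ_le_of_lt hst).eq_or_lt with h | h
      · rw [signedArea_eq_zero_of_eq (by simp [← h]), mul_zero]
      · exact (hε t h (by omega)).le
    by_contra hne
    have := mul_pos (lt_of_le_of_ne hδ (Ne.symm hne)) hpos
    have := mul_nonneg hγ h1
    linarith
  have hγ1 : γ = 1 := by linarith
  have hxt : α • v s + β • v (s + 1) = v t := by rw [← hx, hδ0, hγ1]; simp
  refine ⟨?_, hxt⟩
  rcases (Nat.succ_le_of_lt hst).eq_or_lt with h | h
  · rw [hxt, ← h]
  · have := hε t h (by omega)
    rw [hδ0, hγ1] at h0'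
    linarith

/-- A sequence enumerating `S`, each of whose steps has the later points on one side and each of
whose turning angles is non-obtuse, is a `3π/2`-open spanning path. -/
lemma exists_open_path {S : Finset Pt} (hne : S.Nonempty) (v : ℕ → Pt)
    (hmem : ∀ t < S.card, v t ∈ S) (hinj : ∀ s < S.card, ∀ t < S.card, v s = v t → s = t)
    (hside : ∀ s, ∃ ε : ℝ,
      ∀ t, s + 1 < t → t < S.card → 0 < ε * signedArea (v s) (v (s + 1)) (v t))
    (hang : ∀ t, t + 2 < S.card → 0 ≤ inner ℝ (v t - v (t + 1)) (v (t + 2) - v (t + 1))) :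
    ∃ P : PSLG S, P.IsSpanningPath ∧ P.IsPhiOpen (3 * Real.pi / 2) := by
  have hpos := hne.card_pos
  have hsurj : ∀ x ∈ S, ∃ t < S.card, v t = x := by
    have himg : (Finset.range S.card).image v = S := by
      apply Finset.eq_of_subset_of_card_le
      · intro x hx
        obtain ⟨t, ht, rfl⟩ := Finset.mem_image.1 hx
        exact hmem t (Finset.mem_range.1 ht)
      · rw [Finset.card_image_of_injOn, Finset.card_range]
        intro s hs t ht h
        exact hinj s (by simpa using hs) t (by simpa using ht) h
    intro x hx
    rw [← himg] at hx
    obtain ⟨t, ht, rfl⟩ := Finset.mem_image.1 hx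
    exact ⟨t, Finset.mem_range.1 ht, rfl⟩
  let A := (Finset.range (S.card - 1)).image fun t => (v t, v (t + 1))
  let B := (Finset.range (S.card - 1)).image fun t => (v (t + 1), v t)
  have hE : ∀ e, e ∈ A ∪ B ↔
      ∃ t, t + 1 < S.card ∧ (e = (v t, v (t + 1)) ∨ e = (v (t + 1), v t)) := by
    intro e
    simp only [A, B, Finset.mem_union, Finset.mem_image, Finset.mem_range]
    constructor
    · rintro (⟨t, ht, rfl⟩ | ⟨t, ht, rfl⟩)
      · exact ⟨t, by omega, Or.inl rfl⟩
      · exact ⟨t, by omega, Or.inr rfl⟩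
    · rintro ⟨t, ht, rfl | rfl⟩
      · exact Or.inl ⟨t, by omega, rfl⟩
      · exact Or.inr ⟨t, by omega, rfl⟩
  have hfrom : ∀ t < S.card, ∀ q, (v t, q) ∈ A ∪ B →
      (t + 1 < S.card ∧ q = v (t + 1)) ∨ (0 < t ∧ q = v (t - 1)) := by
    intro t ht q hq
    obtain ⟨s, hs, h | h⟩ := (hE _).1 hq
    · obtain ⟨h1, h2⟩ := Prod.mk.inj h
      obtain rfl := hinj t ht s (by omega) h1
      exact Or.inl ⟨hs, h2⟩
    · obtain ⟨h1, h2⟩ := Prod.mk.inj h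
      obtain rfl := hinj t ht (s + 1) (by omega) h1
      exact Or.inr ⟨by omega, by simpa using h2⟩
  have hcross : ∀ s t, s + 1 < S.card → t + 1 < S.card → s ≠ t →
      ∀ x, x ∈ segment ℝ (v s) (v (s + 1)) → x ∈ segment ℝ (v t) (v (t + 1)) →
        (x = v s ∨ x = v (s + 1)) ∧ (x = v t ∨ x = v (t + 1)) := by
    intro s t hs ht hst x hxs hxt
    rcases lt_or_gt_of_ne hst with h | h
    · obtain ⟨h1, h2⟩ := eq_of_mem_segments hside h ht hxs hxt
      exact ⟨Or.inr h1, Or.inl h2⟩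
    · obtain ⟨h1, h2⟩ := eq_of_mem_segments hside h hs hxt hxs
      exact ⟨Or.inl h2, Or.inr h1⟩
  let P : PSLG S :=
    { E := A ∪ B
      symm := by
        intro e he
        rw [hE] at he ⊢
        obtain ⟨t, ht, rfl | rfl⟩ := he
        · exact ⟨t, ht, Or.inr rfl⟩
        · exact ⟨t, ht, Or.inl rfl⟩
      endpts := by
        intro e he
        obtain ⟨t, ht, rfl | rfl⟩ := (hE e).1 he
        · exact ⟨hmem _ (by omega), hmem _ ht⟩
        · exact ⟨hmem _ ht, hmem _ (by omega)⟩
      ne := by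
        intro e he h
        obtain ⟨t, ht, rfl | rfl⟩ := (hE e).1 he
        · have := hinj _ (by omega) _ ht h
          omega
        · have := hinj _ ht _ (by omega) h
          omega
      noncross := by
        intro e he f hf hef hef' x hxe hxf
        obtain ⟨s, hs, rfl | rfl⟩ := (hE e).1 he <;> obtain ⟨t, ht, rfl | rfl⟩ := (hE f).1 hf <;>
          dsimp only at hxe hxf hef' ⊢ <;>
          have hst : s ≠ t := (by rintro rfl; simp at hef hef') <;>
          first
          | exact hcross s t hs ht hst x hxe hxf
          | exact (hcross s t hs ht hst x hxe (by rwa [segment_symm])).imp id Or.symm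
          | exact (hcross s t hs ht hst x (by rwa [segment_symm]) hxf).imp Or.symm id
          | exact (hcross s t hs ht hst x (by rwa [segment_symm])
              (by rwa [segment_symm])).imp Or.symm Or.symm }
  refine ⟨P, ⟨⟨?_, ?_⟩, ?_⟩, ?_⟩
  · have h0 : ∀ t < S.card, Relation.ReflTransGen (fun a b => (a, b) ∈ P.E) (v 0) (v t) ∧
        Relation.ReflTransGen (fun a b => (a, b) ∈ P.E) (v t) (v 0) := by
      intro t
      induction t with
      | zero => exact fun _ => ⟨.refl, .refl⟩
      | succ t ih =>
        intro ht
        obtain ⟨h1, h2⟩ := ih (by omega)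
        exact ⟨h1.tail ((hE _).2 ⟨t, ht, Or.inl rfl⟩), h2.head ((hE _).2 ⟨t, ht, Or.inr rfl⟩)⟩
    intro x hx y hy
    obtain ⟨s, hs, rfl⟩ := hsurj x hx
    obtain ⟨t, ht, rfl⟩ := hsurj y hy
    exact (h0 s hs).2.trans (h0 t ht).1
  · have hdisj : Disjoint A B := by
      rw [Finset.disjoint_left]
      intro e ha hb
      obtain ⟨s, hs, rfl⟩ := Finset.mem_image.1 ha
      obtain ⟨t, ht, h⟩ := Finset.mem_image.1 hb
      rw [Finset.mem_range] at hs ht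
      obtain ⟨h1, h2⟩ := Prod.mk.inj h
      have := hinj _ (by omega) _ (by omega) h1
      have := hinj _ (by omega) _ (by omega) h2
      omega
    have hA : A.card = S.card - 1 := by
      rw [Finset.card_image_of_injOn, Finset.card_range]
      intro s hs t ht h
      simp only [Finset.coe_range, Set.mem_Iio] at hs ht
      exact hinj _ (by omega) _ (by omega) (Prod.mk.inj h).1
    have hB : B.card = S.card - 1 := by
      rw [Finset.card_image_of_injOn, Finset.card_range]
      intro s hs t ht h
      simp only [Finset.coe_range, Set.mem_Iio] at hs ht
      exact hinj _ (by omega) _ (by omega) (Prod.mk.inj h).2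
    change (A ∪ B).card = _
    rw [Finset.card_union_of_disjoint hdisj, hA, hB]
    omega
  · intro x hx
    obtain ⟨t, ht, rfl⟩ := hsurj x hx
    have hsub : (P.E.filter fun e => e.1 = v t) ⊆ {(v t, v (t + 1)), (v t, v (t - 1))} := by
      rintro ⟨e₁, e₂⟩ he
      obtain ⟨he, rfl⟩ := Finset.mem_filter.1 he
      rcases hfrom t ht e₂ he with ⟨_, rfl⟩ | ⟨_, rfl⟩ <;> simp
    exact (Finset.card_le_card hsub).trans Finset.card_le_two
  · intro x hx
    obtain ⟨t, ht, rfl⟩ := hsurj x hx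
    have hpi : Real.pi - 3 * Real.pi / 2 / 2 = Real.pi / 4 := by ring
    unfold VertexOpen
    rw [hpi]
    have hsub : ∀ s < S.card, s ≠ t → v s - v t ≠ 0 := fun s hs hst h =>
      hst (hinj s hs t ht (sub_eq_zero.1 h))
    by_cases h1 : t + 1 < S.card
    · by_cases h2 : 0 < t
      · obtain ⟨r, rfl⟩ : ∃ r, t = r + 1 := ⟨t - 1, by omega⟩
        obtain ⟨d, hd, ha, hb⟩ := exists_angle_le_quarter (hsub r (by omega) (by omega))
          (hsub (r + 2) h1 (by omega)) (hang r h1)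
        refine ⟨d, hd, fun q hq => ?_⟩
        rcases hfrom _ ht q hq with ⟨_, rfl⟩ | ⟨_, rfl⟩
        · exact hb
        · exact ha
      · have hd := hsub (t + 1) h1 (by omega)
        refine ⟨_, hd, fun q hq => ?_⟩
        rcases hfrom _ ht q hq with ⟨_, rfl⟩ | ⟨h, _⟩
        · rw [InnerProductGeometry.angle_self hd]
          positivity
        · exact absurd h h2
    · by_cases h2 : 0 < t
      · have hd := hsub (t - 1) (by omega) (by omega)
        refine ⟨_, hd, fun q hq => ?_⟩
        rcases hfrom _ ht q hq with ⟨h, _⟩ | ⟨_, rfl⟩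
        · exact absurd h h1
        · rw [InnerProductGeometry.angle_self hd]
          positivity
      · obtain ⟨d, hd⟩ := exists_ne (0 : Pt)
        refine ⟨d, hd, fun q hq => ?_⟩
        rcases hfrom _ ht q hq with ⟨h, _⟩ | ⟨h, _⟩
        · exact absurd h h1
        · exact absurd h h2

/-- The zigzag `q 0, q (n - 1), q 1, q (n - 2), …` is a `3π/2`-open spanning path if its angles
are non-obtuse. -/
lemma exists_open_zigzag {S : Finset Pt} (hne : S.Nonempty) (q : ℤ → Pt) (ε : ℝ)
    (hmem : ∀ i, q i ∈ S) (hinj : ∀ i j : ℤ, i < j → j < i + S.card → q i ≠ q j)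
    (harea : ∀ i j k : ℤ, i < j → j < k → k < i + S.card → 0 < ε * signedArea (q i) (q j) (q k))
    (hang : ∀ j k : ℤ, 0 < j → 0 ≤ k → j + k = S.card - 1 → j ≠ k → j ≠ k + 1 →
      0 ≤ inner ℝ (q k - q j) (q (k + 1) - q j)) :
    ∃ P : PSLG S, P.IsSpanningPath ∧ P.IsPhiOpen (3 * Real.pi / 2) := by
  let v : ℕ → Pt := fun t => if Even t then q ((t / 2 : ℕ) : ℤ) else q (S.card - 1 - (t / 2 : ℕ))
  have hev : ∀ m : ℕ, v (2 * m) = q m := fun m => by simp [v]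
  have hodd : ∀ m : ℕ, v (2 * m + 1) = q (S.card - 1 - m) := fun m => by
    have h1 : ¬ Even (2 * m + 1) := by simp
    have h2 : (2 * m + 1) / 2 = m := by omega
    simp only [v, if_neg h1, h2]
  have hqinj : ∀ i j : ℤ, 0 ≤ i → 0 ≤ j → i < S.card → j < S.card → q i = q j → i = j := by
    intro i j hi hj hi' hj' h
    rcases lt_trichotomy i j with hlt | heq | hlt
    · exact absurd h (hinj i j hlt (by omega))
    · exact heq
    · exact absurd h.symm (hinj j i hlt (by omega))
  refine exists_open_path hne v ?_ ?_ ?_ ?_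
  · intro t _
    obtain ⟨m, rfl | rfl⟩ := t.even_or_odd'
    · rw [hev]; exact hmem _
    · rw [hodd]; exact hmem _
  · intro s hs t ht h
    obtain ⟨m, rfl | rfl⟩ := s.even_or_odd' <;> obtain ⟨l, rfl | rfl⟩ := t.even_or_odd' <;>
      simp only [hev, hodd] at h <;>
      have := hqinj _ _ (by omega) (by omega) (by omega) (by omega) h <;> omega
  · intro s
    obtain ⟨m, rfl | rfl⟩ := s.even_or_odd'
    · refine ⟨-ε, fun t hst ht => ?_⟩
      rw [hev, hodd, signedArea_swap, neg_mul_neg]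
      obtain ⟨l, rfl | rfl⟩ := t.even_or_odd'
      · rw [hev]; exact harea _ _ _ (by omega) (by omega) (by omega)
      · rw [hodd]; exact harea _ _ _ (by omega) (by omega) (by omega)
    · refine ⟨ε, fun t hst ht => ?_⟩
      rw [show 2 * m + 1 + 1 = 2 * (m + 1) by ring, hev, hodd, ← signedArea_rotate]
      obtain ⟨l, rfl | rfl⟩ := t.even_or_odd'
      · rw [hev]; exact harea _ _ _ (by omega) (by omega) (by omega)
      · rw [hodd]; exact harea _ _ _ (by omega) (by omega) (by omega)
  · intro t ht
    obtain ⟨m, rfl | rfl⟩ := t.even_or_odd'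
    · rw [show 2 * m + 2 = 2 * (m + 1) by ring, hev, hodd, hev]
      push_cast
      exact hang _ _ (by omega) (by omega) (by omega) (by omega) (by omega)
    · rw [show 2 * m + 1 + 2 = 2 * (m + 1) + 1 by ring, show 2 * m + 1 + 1 = 2 * (m + 1) by ring,
        hodd, hodd, hev, real_inner_comm]
      have := hang (m + 1 : ℕ) (S.card - 1 - (m + 1 : ℕ)) (by omega) (by omega) (by omega)
        (by omega) (by omega)
      convert this using 4
      push_cast
      ring

/-- Every finite point set in convex position (and general position) admits a `3π/2`-open
non-crossing Hamiltonian spanning path. -/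
theorem stmt13 (S : Finset Pt) (hgp : GenPos S) (hcp : ConvexPos S) (hne : S.Nonempty) :
    ∃ P : PSLG S, P.IsSpanningPath ∧ P.IsPhiOpen (3 * Real.pi / 2) := by
  obtain ⟨p, hp⟩ := exists_ccwCycle hgp hcp hne
  obtain ⟨c, hc⟩ := hp.exists_residue hne
  have hgood : ∀ j k : ℤ, (S.card : ℤ) ∣ j + k - c → j < k → k + 1 < j + S.card →
      0 ≤ inner ℝ (p k - p j) (p (k + 1) - p j) := fun j k hdvd h1 h2 =>
    not_lt.1 fun h => hc j k hdvd ⟨h1, h2, h⟩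
  obtain ⟨s, hs | hs⟩ := c.even_or_odd'
  · refine exists_open_zigzag hne (fun i => p (s - i)) (-1) (fun _ => hp.mem _)
      (fun i j h1 h2 => (hp.ne _ _ (by omega) (by omega)).symm) ?_ ?_
    · intro i j k h1 h2 h3
      have := hp.ccw (s - k) (s - j) (s - i) (by omega) (by omega) (by omega)
      rw [signedArea_swap, ← signedArea_rotate] at this
      linarith
    · intro j k hj hk hjk h1 h2
      rw [real_inner_comm]
      have hk1 : s - k = s - (k + 1) + 1 := by ring
      rcases lt_or_gt_of_ne h1 with hlt | hlt
      · have := hgood (s - j) (s - (k + 1) + 1 * S.card) ⟨0, by linarith⟩ (by omega) (by omega)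
        rwa [add_right_comm, hp.periodic, hp.periodic, ← hk1] at this
      · have := hgood (s - j) (s - (k + 1)) ⟨-1, by linarith⟩ (by omega) (by omega)
        rwa [← hk1] at this
  · refine exists_open_zigzag hne (fun i => p (s + 1 + i)) 1 (fun _ => hp.mem _)
      (fun i j h1 h2 => hp.ne _ _ (by omega) (by omega)) ?_ ?_
    · intro i j k h1 h2 h3
      rw [one_mul]
      exact hp.ccw _ _ _ (by omega) (by omega) (by omega)
    · intro j k hj hk hjk h1 h2
      rw [← add_assoc]
      rcases lt_or_gt_of_ne h1 with hlt | hlt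
      · exact hgood _ _ ⟨1, by linarith⟩ (by omega) (by omega)
      · have := hgood (s + 1 + j) (s + 1 + k + 1 * S.card) ⟨2, by linarith⟩ (by omega) (by omega)
        rwa [add_right_comm _ _ (1 : ℤ), hp.periodic, hp.periodic] at this
end

section
/- Let S be a finite set of points in convex position in general position. For every point p ∈ S there exists a 3π/2-open spanning path of S having p as an endpoint. -/
open scoped Classical
open EuclideanGeometry

namespace ConvexPath

/-- Twice the signed area of the triangle `p q r`. -/
def orient (p q r : Pt) : ℝ := (q 0 - p 0) * (r 1 - p 1) - (q 1 - p 1) * (r 0 - p 0)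

/-- The inner product of the vectors from `q` to `p` and from `q` to `r`. -/
def dot (p q r : Pt) : ℝ := (p 0 - q 0) * (r 0 - q 0) + (p 1 - q 1) * (r 1 - q 1)

theorem orient_rotate (p q r : Pt) : orient q r p = orient p q r := by
  unfold orient; ring

theorem orient_swap (p q r : Pt) : orient p r q = -orient p q r := by
  unfold orient; ring

theorem dot_comm (p q r : Pt) : dot p q r = dot r q p := by
  unfold dot; ring

theorem dot_nonneg_of_neg {p q r : Pt} (h : dot p q r < 0) : 0 ≤ dot p r q := by
  have : dot p q r + dot p r q = (q 0 - r 0) ^ 2 + (q 1 - r 1) ^ 2 := by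
    unfold dot; ring
  nlinarith [sq_nonneg (q 0 - r 0), sq_nonneg (q 1 - r 1)]

/-- `a b c d` are the vertices of a strictly convex quadrilateral in counterclockwise order. -/
structure Quad (a b c d : Pt) : Prop where
  abc : 0 < orient a b c
  abd : 0 < orient a b d
  acd : 0 < orient a c d
  bcd : 0 < orient b c d

namespace Quad

variable {a b c d : Pt}

theorem rotate (h : Quad a b c d) : Quad b c d a :=
  ⟨h.bcd, by rw [orient_rotate]; exact h.abc, by rw [orient_rotate]; exact h.abd,
    by rw [orient_rotate]; exact h.acd⟩

theorem dot_nonneg_or (h : Quad a b c d) : 0 ≤ dot b a c ∨ 0 ≤ dot d a c := by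
  by_contra! hn
  have key : orient a b d * ((c 0 - a 0) ^ 2 + (c 1 - a 1) ^ 2)
      = orient a c d * dot b a c + orient a b c * dot d a c := by
    unfold orient dot; ring
  have h1 := mul_neg_of_pos_of_neg h.acd hn.1
  have h2 := mul_neg_of_pos_of_neg h.abc hn.2
  have h3 : 0 ≤ orient a b d * ((c 0 - a 0) ^ 2 + (c 1 - a 1) ^ 2) :=
    mul_nonneg h.abd.le (by positivity)
  linarith

theorem dot_nonneg_left (h : Quad a b c d) (hd : 0 ≤ dot b a d) : 0 ≤ dot b a c := by
  have key : orient a b d * dot b a c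
      = orient a c d * ((b 0 - a 0) ^ 2 + (b 1 - a 1) ^ 2) + orient a b c * dot b a d := by
    unfold orient dot; ring
  refine nonneg_of_mul_nonneg_right ?_ h.abd
  rw [key]
  exact add_nonneg (mul_nonneg h.acd.le (by positivity)) (mul_nonneg h.abc.le hd)

theorem dot_nonneg_right (h : Quad a b c d) (hd : 0 ≤ dot b a d) : 0 ≤ dot c a d := by
  have key : orient a b d * dot c a d
      = orient a b c * ((d 0 - a 0) ^ 2 + (d 1 - a 1) ^ 2) + orient a c d * dot b a d := by
    unfold orient dot; ring
  refine nonneg_of_mul_nonneg_right ?_ h.abd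
  rw [key]
  exact add_nonneg (mul_nonneg h.abc.le (by positivity)) (mul_nonneg h.acd.le hd)

end Quad

/-- Consecutive points of the list are joined by a path without angles larger than `π / 2`,
each edge having all the later points strictly on one side. -/
def IsGood : List Pt → Prop
  | v :: w :: r => v ∉ w :: r ∧ ((∀ z ∈ r, 0 < orient v w z) ∨ (∀ z ∈ r, orient v w z < 0)) ∧
      (∀ u ∈ r.head?, 0 ≤ dot v w u) ∧ IsGood (w :: r)
  | _ => True

/-- `f 0, …, f (n - 1)` are distinct and every three of them are in counterclockwise order. -/
structure IsCcw (f : ℕ → Pt) (n : ℕ) : Prop where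
  inj : ∀ i < n, ∀ j < n, f i = f j → i = j
  pos : ∀ i j k, i < j → j < k → k < n → 0 < orient (f i) (f j) (f k)

theorem IsCcw.quad {f : ℕ → Pt} {n : ℕ} (h : IsCcw f n) {a b c d : ℕ} (hab : a < b)
    (hbc : b < c) (hcd : c < d) (hd : d < n) : Quad (f a) (f b) (f c) (f d) :=
  ⟨h.pos _ _ _ hab hbc (by lia), h.pos _ _ _ hab (by lia) hd, h.pos _ _ _ (by lia) hcd hd,
    h.pos _ _ _ hbc hcd hd⟩

/-- `l` lists the indices from `i` to `j` in the order of a good path. -/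
def Covers (f : ℕ → Pt) (i j : ℕ) (l : List ℕ) : Prop :=
  IsGood (l.map f) ∧ ∀ x, x ∈ l ↔ i ≤ x ∧ x ≤ j

variable {f : ℕ → Pt} {n i j w : ℕ} {r : List ℕ}

theorem covers_singleton (i : ℕ) : Covers f i i [i] :=
  ⟨by simp [IsGood], fun x => by simp; lia⟩

theorem Covers.mem_tail (h : Covers f i j (w :: r)) {x : ℕ}
    (hx : x ∈ r) : i ≤ x ∧ x ≤ j ∧ x ≠ w := by
  have h1 := (h.2 x).1 (by simp [hx])
  refine ⟨h1.1, h1.2, ?_⟩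
  rintro rfl
  obtain ⟨hg, -⟩ := h
  cases r with
  | nil => simp at hx
  | cons y t =>
    simp only [List.map_cons, IsGood] at hg
    apply hg.1
    rw [← List.map_cons]
    exact List.mem_map_of_mem hx

theorem Covers.cons_left (hf : IsCcw f n) (hj : j < n) (h : Covers f (i + 1) j (w :: r))
    (hw : w = i + 1 ∨ w = j) (ha : ∀ u ∈ r.head?, 0 ≤ dot (f i) (f w) (f u)) :
    Covers f i j (i :: w :: r) := by
  have hij : i + 1 ≤ j := by have := (h.2 w).1 (by simp); lia
  have ht := fun x => h.mem_tail (x := x)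
  refine ⟨?_, fun x => ?_⟩
  · simp only [List.map_cons, IsGood]
    refine ⟨?_, ?_, ?_, by simpa using h.1⟩
    · rw [← List.map_cons]
      intro hm
      obtain ⟨x, hx, he⟩ := List.mem_map.1 hm
      have := (h.2 x).1 hx
      have := hf.inj x (by lia) i (by lia) he
      lia
    · simp only [List.mem_map, forall_exists_index, and_imp, forall_apply_eq_imp_iff₂]
      by_cases hw' : w = i + 1
      · left
        intro z hz
        have := ht z hz
        exact hf.pos _ _ _ (by lia) (by lia) (by lia)
      · right
        intro z hz
        have := ht z hz
        rw [orient_swap]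
        have := hf.pos i z w (by lia) (by lia) (by lia)
        linarith
    · cases r <;> simp_all
  · rw [List.mem_cons, h.2]; lia

theorem Covers.cons_right (hf : IsCcw f n) (hj : j + 1 < n) (h : Covers f i j (w :: r))
    (hw : w = i ∨ w = j) (ha : ∀ u ∈ r.head?, 0 ≤ dot (f (j + 1)) (f w) (f u)) :
    Covers f i (j + 1) ((j + 1) :: w :: r) := by
  have hij : i ≤ j := by have := (h.2 w).1 (by simp); lia
  have ht := fun x => h.mem_tail (x := x)
  refine ⟨?_, fun x => ?_⟩
  · simp only [List.map_cons, IsGood]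
    refine ⟨?_, ?_, ?_, by simpa using h.1⟩
    · rw [← List.map_cons]
      intro hm
      obtain ⟨x, hx, he⟩ := List.mem_map.1 hm
      have := (h.2 x).1 hx
      have := hf.inj x (by lia) (j + 1) (by lia) he
      lia
    · simp only [List.mem_map, forall_exists_index, and_imp, forall_apply_eq_imp_iff₂]
      by_cases hw' : w = i
      · left
        intro z hz
        have := ht z hz
        rw [← orient_rotate]
        exact hf.pos _ _ _ (by lia) (by lia) (by lia)
      · right
        intro z hz
        have := ht z hz
        rw [orient_swap, orient_rotate, orient_rotate, orient_rotate]
        have := hf.pos z w (j + 1) (by lia) (by lia) (by lia)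
        rw [← orient_rotate] at this
        rw [← orient_rotate] at this
        linarith
    · cases r <;> simp_all
  · rw [List.mem_cons, h.2]; lia

theorem forall_head_of_forall {α : Type*} {P : α → Prop} {l : List α} (h : ∀ x ∈ l, P x) :
    ∀ u ∈ l.head?, P u := by
  cases l <;> simp_all

theorem exists_path_left (hf : IsCcw f n) (hij : i ≤ j) (hj : j < n)
    (ihl : ∀ i' j', i < i' → i' ≤ j' → j' ≤ j → ∃ l, Covers f i' j' (i' :: l))
    (ihr : ∀ i' j', i < i' → i' ≤ j' → j' ≤ j → ∃ l, Covers f i' j' (j' :: l))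
    (ihe : ∀ i' j', i < i' → i' < j' → j' ≤ j →
      ∃ l, Covers f i' j' (i' :: j' :: l) ∨ Covers f i' j' (j' :: i' :: l)) :
    ∃ l, Covers f i j (i :: l) := by
  rcases hij.eq_or_lt with rfl | hlt
  · exact ⟨[], covers_singleton i⟩
  rcases Nat.lt_or_ge (i + 1) j with hlt2 | hge
  · obtain ⟨l, h | h⟩ := ihe (i + 1) j (by lia) hlt2 le_rfl
    · by_cases hg : 0 ≤ dot (f i) (f (i + 1)) (f j)
      · exact ⟨_, h.cons_left hf hj (.inl rfl) (by simpa using hg)⟩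
      · obtain ⟨k, rfl⟩ : ∃ k, j = k + 1 := ⟨j - 1, by lia⟩
        obtain ⟨t, ht⟩ := ihl (i + 1) k (by lia) (by lia) (by lia)
        refine ⟨_, (ht.cons_right hf hj (.inl rfl) (forall_head_of_forall fun x hx => ?_)).cons_left
          hf hj (.inr rfl) (by simpa using dot_nonneg_of_neg (not_le.1 hg))⟩
        have hx := ht.mem_tail hx
        rw [dot_comm]
        exact ((hf.quad (a := i) (b := i + 1) (c := x) (d := k + 1) (by lia) (by lia) (by lia)
          hj).rotate.dot_nonneg_or).resolve_right hg
    · by_cases hg : 0 ≤ dot (f i) (f j) (f (i + 1))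
      · exact ⟨_, h.cons_left hf hj (.inr rfl) (by simpa using hg)⟩
      · obtain ⟨t, ht⟩ := ihr (i + 2) j (by lia) (by lia) (by lia)
        refine ⟨_, (ht.cons_left hf hj (.inr rfl) (forall_head_of_forall fun x hx => ?_)).cons_left
          hf hj (.inl rfl) (by simpa using dot_nonneg_of_neg (not_le.1 hg))⟩
        have hx := ht.mem_tail hx
        rw [dot_comm]
        exact ((hf.quad (a := i) (b := i + 1) (c := x) (d := j) (by lia) (by lia) (by lia)
          hj).rotate.rotate.rotate.dot_nonneg_or).resolve_left hg
  · obtain rfl : j = i + 1 := by lia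
    exact ⟨_, (covers_singleton (i + 1)).cons_left hf hj (.inl rfl) (by simp)⟩

theorem exists_path_right (hf : IsCcw f n) (hij : i ≤ j) (hj : j < n)
    (ihl : ∀ i' j', i ≤ i' → i' ≤ j' → j' < j → ∃ l, Covers f i' j' (i' :: l))
    (ihr : ∀ i' j', i ≤ i' → i' ≤ j' → j' < j → ∃ l, Covers f i' j' (j' :: l))
    (ihe : ∀ i' j', i ≤ i' → i' < j' → j' < j →
      ∃ l, Covers f i' j' (i' :: j' :: l) ∨ Covers f i' j' (j' :: i' :: l)) :
    ∃ l, Covers f i j (j :: l) := by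
  rcases hij.eq_or_lt with rfl | hlt
  · exact ⟨[], covers_singleton i⟩
  obtain ⟨k, rfl⟩ : ∃ k, j = k + 1 := ⟨j - 1, by lia⟩
  rcases Nat.lt_or_ge i k with hlt2 | hge
  · obtain ⟨l, h | h⟩ := ihe i k le_rfl hlt2 (by lia)
    · by_cases hg : 0 ≤ dot (f (k + 1)) (f i) (f k)
      · exact ⟨_, h.cons_right hf hj (.inl rfl) (by simpa using hg)⟩
      · obtain ⟨m, rfl⟩ : ∃ m, k = m + 1 := ⟨k - 1, by lia⟩
        obtain ⟨t, ht⟩ := ihl i m (by lia) (by lia) (by lia)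
        refine ⟨_, (ht.cons_right hf (by lia) (.inl rfl)
          (forall_head_of_forall fun x hx => ?_)).cons_right
          hf hj (.inr rfl) (by simpa using dot_nonneg_of_neg (not_le.1 hg))⟩
        have hx := ht.mem_tail hx
        rw [dot_comm]
        exact ((hf.quad (a := i) (b := x) (c := m + 1) (d := m + 1 + 1) (by lia) (by lia) (by lia)
          hj).dot_nonneg_or).resolve_right hg
    · by_cases hg : 0 ≤ dot (f (k + 1)) (f k) (f i)
      · exact ⟨_, h.cons_right hf hj (.inr rfl) (by simpa using hg)⟩
      · obtain ⟨t, ht⟩ := ihr (i + 1) k (by lia) (by lia) (by lia)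
        refine ⟨_, (ht.cons_left hf (by lia) (.inr rfl)
          (forall_head_of_forall fun x hx => ?_)).cons_right
          hf hj (.inl rfl) (by simpa using dot_nonneg_of_neg (not_le.1 hg))⟩
        have hx := ht.mem_tail hx
        rw [dot_comm]
        exact ((hf.quad (a := i) (b := x) (c := k) (d := k + 1) (by lia) (by lia) (by lia)
          hj).rotate.rotate.dot_nonneg_or).resolve_left hg
  · obtain rfl : i = k := by lia
    exact ⟨_, (covers_singleton i).cons_right hf hj (.inl rfl) (by simp)⟩

theorem exists_path_edge (hf : IsCcw f n) (hij : i < j) (hj : j < n)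
    (ihl : ∀ i' j', i ≤ i' → i' ≤ j' → j' < j → ∃ l, Covers f i' j' (i' :: l))
    (ihr : ∀ i' j', i < i' → i' ≤ j' → j' ≤ j → ∃ l, Covers f i' j' (j' :: l))
    (ihe : ∀ i' j', i < i' → i' < j' → j' < j →
      ∃ l, Covers f i' j' (i' :: j' :: l) ∨ Covers f i' j' (j' :: i' :: l)) :
    ∃ l, Covers f i j (i :: j :: l) ∨ Covers f i j (j :: i :: l) := by
  obtain ⟨k, rfl⟩ : ∃ k, j = k + 1 := ⟨j - 1, by lia⟩
  have hleft (hh : ∀ x, i < x → x < k + 1 → 0 ≤ dot (f i) (f (k + 1)) (f x)) :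
      ∃ l, Covers f i (k + 1) (i :: (k + 1) :: l) := by
    obtain ⟨t, ht⟩ := ihr (i + 1) (k + 1) (by lia) (by lia) le_rfl
    refine ⟨t, ht.cons_left hf hj (.inr rfl) (forall_head_of_forall fun x hx => ?_)⟩
    have hx := ht.mem_tail hx
    exact hh x (by lia) (by lia)
  have hright (hh : ∀ x, i < x → x < k + 1 → 0 ≤ dot (f (k + 1)) (f i) (f x)) :
      ∃ l, Covers f i (k + 1) ((k + 1) :: i :: l) := by
    obtain ⟨t, ht⟩ := ihl i k (by lia) (by lia) (by lia)
    refine ⟨t, ht.cons_right hf hj (.inl rfl) (forall_head_of_forall fun x hx => ?_)⟩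
    have hx := ht.mem_tail hx
    exact hh x (by lia) (by lia)
  by_cases hb : 0 ≤ dot (f (k + 1)) (f i) (f k)
  swap
  · have h1 : 0 ≤ dot (f i) (f (k + 1)) (f k) := by
      rw [dot_comm]
      rw [dot_comm] at hb
      exact dot_nonneg_of_neg (not_le.1 hb)
    refine (hleft fun x hx hxk => ?_).imp fun _ => Or.inl
    rcases (show x ≤ k by lia).eq_or_lt with rfl | hlt
    · exact h1
    · exact (hf.quad hx hlt (by lia) hj).rotate.rotate.rotate.dot_nonneg_left h1
  by_cases ha : 0 ≤ dot (f i) (f (k + 1)) (f (i + 1))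
  swap
  · have h1 : 0 ≤ dot (f (i + 1)) (f i) (f (k + 1)) := by
      rw [dot_comm] at ha
      exact dot_nonneg_of_neg (not_le.1 ha)
    refine (hright fun x hx hxk => ?_).imp fun _ => Or.inr
    rw [dot_comm]
    rcases (show i + 1 ≤ x by lia).eq_or_lt with rfl | hlt
    · exact h1
    · exact (hf.quad (by lia) hlt hxk hj).dot_nonneg_right h1
  rcases Nat.lt_or_ge (i + 1) k with hlt | hge
  swap
  · refine (hleft fun x hx hxk => ?_).imp fun _ => Or.inl
    obtain rfl : x = i + 1 := by lia
    exact ha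
  obtain ⟨l, h | h⟩ := ihe (i + 1) k (by lia) hlt (by lia)
  · by_cases hg : 0 ≤ dot (f (k + 1)) (f (i + 1)) (f k)
    · exact ⟨_, .inl ((h.cons_right hf hj (.inl rfl) (by simpa using hg)).cons_left hf hj
        (.inr rfl) (by simpa using ha))⟩
    · obtain ⟨m, rfl⟩ : ∃ m, k = m + 1 := ⟨k - 1, by lia⟩
      obtain ⟨t, ht⟩ := ihl (i + 1) m (by lia) (by lia) (by lia)
      have h1 := (hf.quad (a := i) (b := i + 1) (c := m + 1) (d := m + 1 + 1) (by lia) hlt (by lia)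
        hj).rotate.rotate.dot_nonneg_right (dot_nonneg_of_neg (not_le.1 hg))
      refine ⟨_, .inr (((ht.cons_right hf (by lia) (.inl rfl)
        (forall_head_of_forall fun x hx => ?_)).cons_left hf (by lia) (.inr rfl)
          (by simpa using h1)).cons_right hf hj (.inl rfl) (by simpa using hb))⟩
      have hx := ht.mem_tail hx
      rw [dot_comm]
      exact (hf.quad (a := i + 1) (b := x) (c := m + 1) (d := m + 1 + 1) (by lia) (by lia) (by lia)
        hj).dot_nonneg_or.resolve_right hg
  · by_cases hg : 0 ≤ dot (f i) (f k) (f (i + 1))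
    · exact ⟨_, .inr ((h.cons_left hf (by lia) (.inr rfl) (by simpa using hg)).cons_right hf hj
        (.inl rfl) (by simpa using hb))⟩
    · obtain ⟨t, ht⟩ := ihr (i + 2) k (by lia) (by lia) (by lia)
      have h1 := dot_nonneg_of_neg (not_le.1 hg)
      rw [dot_comm] at h1
      have h2 := (hf.quad (a := i) (b := i + 1) (c := k) (d := k + 1) (by lia) hlt (by lia)
        hj).rotate.dot_nonneg_left h1
      rw [dot_comm] at h2
      refine ⟨_, .inl (((ht.cons_left hf (by lia) (.inr rfl)
        (forall_head_of_forall fun x hx => ?_)).cons_right hf hj (.inl rfl)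
          (by simpa using h2)).cons_left hf hj (.inr rfl) (by simpa using ha))⟩
      have hx := ht.mem_tail hx
      rw [dot_comm]
      exact (hf.quad (a := i) (b := i + 1) (c := x) (d := k) (by lia) (by lia) (by lia)
        (by lia)).rotate.rotate.rotate.dot_nonneg_or.resolve_left hg

theorem exists_paths (hf : IsCcw f n) (m : ℕ) : ∀ i j, i ≤ j → j < n → j - i = m →
    (∃ l, Covers f i j (i :: l)) ∧ (∃ l, Covers f i j (j :: l)) ∧
    (i < j → ∃ l, Covers f i j (i :: j :: l) ∨ Covers f i j (j :: i :: l)) := by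
  induction m using Nat.strong_induction_on with
  | _ m ih =>
    intro i j hij hj hm
    refine ⟨exists_path_left hf hij hj ?_ ?_ ?_, exists_path_right hf hij hj ?_ ?_ ?_,
      fun hlt => exists_path_edge hf hlt hj ?_ ?_ ?_⟩
    · exact fun i' j' _ _ _ => (ih (j' - i') (by lia) i' j' (by lia) (by lia) rfl).1
    · exact fun i' j' _ _ _ => (ih (j' - i') (by lia) i' j' (by lia) (by lia) rfl).2.1
    · exact fun i' j' _ h _ => (ih (j' - i') (by lia) i' j' (by lia) (by lia) rfl).2.2 h
    · exact fun i' j' _ _ _ => (ih (j' - i') (by lia) i' j' (by lia) (by lia) rfl).1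
    · exact fun i' j' _ _ _ => (ih (j' - i') (by lia) i' j' (by lia) (by lia) rfl).2.1
    · exact fun i' j' _ h _ => (ih (j' - i') (by lia) i' j' (by lia) (by lia) rfl).2.2 h
    · exact fun i' j' _ _ _ => (ih (j' - i') (by lia) i' j' (by lia) (by lia) rfl).1
    · exact fun i' j' _ _ _ => (ih (j' - i') (by lia) i' j' (by lia) (by lia) rfl).2.1
    · exact fun i' j' _ h _ => (ih (j' - i') (by lia) i' j' (by lia) (by lia) rfl).2.2 h


/-- The edges of the path through the points of a list, each in both directions. -/
noncomputable def edges : List Pt → Finset (Pt × Pt)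
  | v :: w :: r => insert (v, w) (insert (w, v) (edges (w :: r)))
  | _ => ∅

theorem mem_edges_cons {v w : Pt} {r : List Pt} {e : Pt × Pt} :
    e ∈ edges (v :: w :: r) ↔ e = (v, w) ∨ e = (w, v) ∨ e ∈ edges (w :: r) := by
  simp [edges]

theorem mem_of_mem_edges : ∀ {l : List Pt} {e : Pt × Pt}, e ∈ edges l → e.1 ∈ l ∧ e.2 ∈ l
  | [], e, h => by simp [edges] at h
  | [x], e, h => by simp [edges] at h
  | v :: w :: r, e, h => by
    rcases mem_edges_cons.1 h with rfl | rfl | h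
    · simp
    · simp
    · have := mem_of_mem_edges h
      exact ⟨List.mem_cons_of_mem _ this.1, List.mem_cons_of_mem _ this.2⟩

theorem swap_mem_edges : ∀ {l : List Pt} {e : Pt × Pt}, e ∈ edges l → (e.2, e.1) ∈ edges l
  | [], e, h => by simp [edges] at h
  | [x], e, h => by simp [edges] at h
  | v :: w :: r, e, h => by
    rw [mem_edges_cons]
    rcases mem_edges_cons.1 h with rfl | rfl | h
    · simp
    · simp
    · exact .inr (.inr (swap_mem_edges h))

theorem IsGood.nodup : ∀ {l : List Pt}, IsGood l → l.Nodup
  | [], _ => by simp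
  | [x], _ => by simp
  | v :: w :: r, h => by
    rw [IsGood] at h
    exact List.nodup_cons.2 ⟨h.1, h.2.2.2.nodup⟩

theorem ne_of_mem_edges : ∀ {l : List Pt} {e : Pt × Pt}, l.Nodup → e ∈ edges l → e.1 ≠ e.2
  | [], e, _, h => by simp [edges] at h
  | [x], e, _, h => by simp [edges] at h
  | v :: w :: r, e, hl, h => by
    rw [List.nodup_cons] at hl
    rcases mem_edges_cons.1 h with rfl | rfl | h
    · rintro (rfl : v = w); simp at hl
    · rintro (rfl : w = v); simp at hl
    · exact ne_of_mem_edges hl.2 h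

theorem card_edges : ∀ {l : List Pt}, l.Nodup → (edges l).card = 2 * (l.length - 1)
  | [], _ => by simp [edges]
  | [x], _ => by simp [edges]
  | v :: w :: r, hl => by
    rw [List.nodup_cons] at hl
    have hw : v ≠ w := by rintro rfl; simp at hl
    have h1 : (w, v) ∉ edges (w :: r) := fun h => hl.1 (mem_of_mem_edges h).2
    have h2 : (v, w) ∉ insert (w, v) (edges (w :: r)) := by
      rw [Finset.mem_insert, not_or]
      exact ⟨by simp [hw], fun h => hl.1 (mem_of_mem_edges h).1⟩
    rw [edges, Finset.card_insert_of_notMem h2, Finset.card_insert_of_notMem h1,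
      card_edges hl.2]
    simp only [List.length_cons]
    lia

theorem reachable_edges : ∀ {l : List Pt}, ∀ p ∈ l, ∀ q ∈ l,
    Relation.ReflTransGen (fun a b => (a, b) ∈ edges l) p q
  | [], p, hp, _, _ => by simp at hp
  | [x], p, hp, q, hq => by
    rw [List.mem_singleton] at hp hq
    rw [hp, hq]
  | v :: w :: r, p, hp, q, hq => by
    have key : ∀ a ∈ w :: r, ∀ b ∈ w :: r,
        Relation.ReflTransGen (fun a b => (a, b) ∈ edges (v :: w :: r)) a b := fun a ha b hb =>
      Relation.ReflTransGen.mono (fun _ _ h => mem_edges_cons.2 (.inr (.inr h))) _ _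
        (reachable_edges a ha b hb)
    have hvw : (v, w) ∈ edges (v :: w :: r) := mem_edges_cons.2 (.inl rfl)
    have hwv : (w, v) ∈ edges (v :: w :: r) := mem_edges_cons.2 (.inr (.inl rfl))
    rcases List.mem_cons.1 hp with hpv | hp <;> rcases List.mem_cons.1 hq with hqv | hq
    · rw [hpv, hqv]
    · rw [hpv]
      exact .head hvw (key w (by simp) q hq)
    · rw [hqv]
      exact .tail (key p hp w (by simp)) hwv
    · exact key p hp q hq

theorem orient_eq_zero_of_mem_segment {v w x : Pt} (hx : x ∈ segment ℝ v w) :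
    orient v w x = 0 := by
  obtain ⟨s, t, -, -, hst, rfl⟩ := hx
  obtain rfl : s = 1 - t := by linarith
  simp [orient]
  ring

theorem orient_combination {v w a b : Pt} {s t : ℝ} (hst : s + t = 1) :
    orient v w (s • a + t • b) = s * orient v w a + t * orient v w b := by
  obtain rfl : s = 1 - t := by linarith
  simp [orient]
  ring

theorem orient_self_right (v w : Pt) : orient v w w = 0 := by
  unfold orient; ring

/-- A segment with endpoints on one side of the line `v w` or at `w` meets the line only
at `w`. -/
theorem eq_of_mem_segment {v w a b x : Pt} {r : List Pt}
    (hs : (∀ z ∈ r, 0 < orient v w z) ∨ (∀ z ∈ r, orient v w z < 0))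
    (ha : a ∈ w :: r) (hb : b ∈ w :: r) (hab : a ≠ b)
    (hx : x ∈ segment ℝ v w) (hx' : x ∈ segment ℝ a b) : x = w ∧ (x = a ∨ x = b) := by
  have h0 := orient_eq_zero_of_mem_segment hx
  obtain ⟨s, t, hs0, ht0, hst, rfl⟩ := hx'
  rw [orient_combination hst] at h0
  rw [List.mem_cons] at ha hb
  rcases ha with rfl | ha <;> rcases hb with rfl | hb
  · exact absurd rfl hab
  · have hb' : orient v a b ≠ 0 := hs.elim (fun h => (h b hb).ne') (fun h => (h b hb).ne)
    rw [orient_self_right, mul_zero, zero_add, mul_eq_zero, or_iff_left hb'] at h0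
    obtain rfl : s = 1 := by linarith
    simp [h0]
  · have ha' : orient v b a ≠ 0 := hs.elim (fun h => (h a ha).ne') (fun h => (h a ha).ne)
    rw [orient_self_right, mul_zero, add_zero, mul_eq_zero, or_iff_left ha'] at h0
    obtain rfl : t = 1 := by linarith
    simp [h0]
  · exfalso
    rcases hs with hs | hs
    · rcases hs0.eq_or_lt with rfl | hs0
      · nlinarith [hs b hb]
      · nlinarith [mul_pos hs0 (hs a ha), mul_nonneg ht0 (hs b hb).le]
    · rcases hs0.eq_or_lt with rfl | hs0
      · nlinarith [hs b hb]
      · nlinarith [mul_neg_of_pos_of_neg hs0 (hs a ha),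
          mul_nonpos_of_nonneg_of_nonpos ht0 (hs b hb).le]

theorem IsGood.noncross : ∀ {l : List Pt}, IsGood l → ∀ e ∈ edges l, ∀ f ∈ edges l, e ≠ f →
    e ≠ (f.2, f.1) → ∀ x, x ∈ segment ℝ e.1 e.2 → x ∈ segment ℝ f.1 f.2 →
      (x = e.1 ∨ x = e.2) ∧ (x = f.1 ∨ x = f.2)
  | [], _, e, he, _, _ => by simp [edges] at he
  | [x], _, e, he, _, _ => by simp [edges] at he
  | v :: w :: r, h, e, he, f, hf => by
    intro hne hne' x hxe hxf
    have hnd := h.nodup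
    rw [IsGood] at h
    rw [List.nodup_cons] at hnd
    have key : ∀ g ∈ edges (w :: r), x ∈ segment ℝ v w → x ∈ segment ℝ g.1 g.2 →
        x = w ∧ (x = g.1 ∨ x = g.2) := fun g hg =>
      eq_of_mem_segment h.2.1 (mem_of_mem_edges hg).1 (mem_of_mem_edges hg).2
        (ne_of_mem_edges hnd.2 hg)
    rcases mem_edges_cons.1 he with rfl | rfl | he <;>
      rcases mem_edges_cons.1 hf with rfl | rfl | hf
    · exact absurd rfl hne
    · exact absurd rfl hne'
    · exact ⟨.inr (key f hf hxe hxf).1, (key f hf hxe hxf).2⟩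
    · exact absurd rfl hne'
    · exact absurd rfl hne
    · rw [segment_symm] at hxe
      exact ⟨.inl (key f hf hxe hxf).1, (key f hf hxe hxf).2⟩
    · exact ⟨(key e he hxf hxe).2, .inr (key e he hxf hxe).1⟩
    · rw [segment_symm] at hxf
      exact ⟨(key e he hxf hxe).2, .inl (key e he hxf hxe).1⟩
    · exact h.2.2.2.noncross e he f hf hne hne' x hxe hxf

theorem filter_edges_cons_self {v w : Pt} {r : List Pt} (h : v ∉ w :: r) :
    (edges (v :: w :: r)).filter (fun e => e.1 = v) = {(v, w)} := by
  ext e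
  rw [Finset.mem_filter, mem_edges_cons, Finset.mem_singleton]
  constructor
  · rintro ⟨rfl | rfl | he, h1⟩
    · rfl
    · exact absurd (by simp [← h1]) h
    · exact absurd (h1 ▸ (mem_of_mem_edges he).1) h
  · rintro rfl
    simp

theorem card_filter_head_le {v : Pt} {l : List Pt} (h : (v :: l).Nodup) :
    ((edges (v :: l)).filter fun e => e.1 = v).card ≤ 1 := by
  cases l with
  | nil => simp [edges]
  | cons w r => rw [filter_edges_cons_self (List.nodup_cons.1 h).1, Finset.card_singleton]

theorem card_filter_le : ∀ {l : List Pt}, l.Nodup → ∀ p,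
    ((edges l).filter fun e => e.1 = p).card ≤ 2
  | [], _, p => by simp [edges]
  | [x], _, p => by simp [edges]
  | v :: w :: r, h, p => by
    have hl := List.nodup_cons.1 h
    by_cases hpv : p = v
    · subst hpv
      exact (card_filter_head_le h).trans (by norm_num)
    by_cases hpw : p = w
    · subst hpw
      have hsub : (edges (v :: p :: r)).filter (fun e => e.1 = p) ⊆
          insert (p, v) ((edges (p :: r)).filter fun e => e.1 = p) := by
        intro e
        rw [Finset.mem_filter, mem_edges_cons, Finset.mem_insert, Finset.mem_filter]
        rintro ⟨rfl | rfl | he, h1⟩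
        · exact absurd h1.symm hpv
        · exact .inl rfl
        · exact .inr ⟨he, h1⟩
      exact (Finset.card_le_card hsub).trans ((Finset.card_insert_le _ _).trans
        (Nat.succ_le_succ (card_filter_head_le hl.2)))
    · have heq : (edges (v :: w :: r)).filter (fun e => e.1 = p) =
          (edges (w :: r)).filter (fun e => e.1 = p) := by
        ext e
        rw [Finset.mem_filter, Finset.mem_filter, mem_edges_cons]
        constructor
        · rintro ⟨rfl | rfl | he, h1⟩
          · exact absurd h1.symm hpv
          · exact absurd h1.symm hpw
          · exact ⟨he, h1⟩
        · exact fun ⟨he, h1⟩ => ⟨.inr (.inr he), h1⟩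
      rw [heq]
      exact card_filter_le hl.2 p

/-- The sum of two unit vectors at angle at most `π / 2` is within `π / 4` of the second. -/
theorem angle_add_le {E : Type*} [NormedAddCommGroup E] [InnerProductSpace ℝ E] {x y : E}
    (hx : ‖x‖ = 1) (hy : ‖y‖ = 1) (h : 0 ≤ inner ℝ x y) : InnerProductGeometry.angle (x + y) y ≤ Real.pi / 4 := by
  have hin : inner ℝ (x + y) y = 1 + inner ℝ x y := by
    rw [inner_add_left, real_inner_self_eq_norm_sq, hy]; ring
  have hn : ‖x + y‖ ^ 2 = 2 * (1 + inner ℝ x y) := by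
    rw [norm_add_sq_real, hx, hy]; ring
  have hpos : 0 < ‖x + y‖ := by
    by_contra hc
    have : ‖x + y‖ = 0 := le_antisymm (not_lt.1 hc) (norm_nonneg _)
    rw [this] at hn
    linarith
  have h2 : √2 / 2 ≤ (1 + inner ℝ x y) / ‖x + y‖ := by
    have hsq : √2 ^ 2 = 2 := Real.sq_sqrt (by norm_num)
    have hge : √2 ≤ ‖x + y‖ := Real.sqrt_le_iff.2 ⟨hpos.le, by linarith⟩
    rw [le_div_iff₀ hpos]
    nlinarith
  rw [InnerProductGeometry.angle, hin, hy, mul_one]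
  calc Real.arccos _ ≤ Real.arccos (√2 / 2) := Real.arccos_le_arccos h2
    _ = Real.pi / 4 := by
      rw [← Real.cos_pi_div_four, Real.arccos_cos] <;> linarith [Real.pi_pos]

theorem exists_angle_le {E : Type*} [NormedAddCommGroup E] [InnerProductSpace ℝ E] {x y : E}
    (hx : x ≠ 0) (hy : y ≠ 0) (h : 0 ≤ inner ℝ x y) :
    ∃ d : E, d ≠ 0 ∧ InnerProductGeometry.angle d x ≤ Real.pi / 4 ∧ InnerProductGeometry.angle d y ≤ Real.pi / 4 := by
  have hx0 := inv_pos.2 (norm_pos_iff.2 hx)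
  have hy0 := inv_pos.2 (norm_pos_iff.2 hy)
  have hx1 : ‖‖x‖⁻¹ • x‖ = 1 := norm_smul_inv_norm hx
  have hy1 : ‖‖y‖⁻¹ • y‖ = 1 := norm_smul_inv_norm hy
  have h1 : 0 ≤ inner ℝ (‖x‖⁻¹ • x) (‖y‖⁻¹ • y) := by
    rw [real_inner_smul_left, real_inner_smul_right]
    positivity
  refine ⟨‖x‖⁻¹ • x + ‖y‖⁻¹ • y, fun h0 => ?_, ?_, ?_⟩
  · have := norm_add_sq_real (‖x‖⁻¹ • x) (‖y‖⁻¹ • y)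
    rw [h0, hx1, hy1, norm_zero] at this
    linarith
  · rw [← InnerProductGeometry.angle_smul_right_of_pos _ x hx0, add_comm]
    exact angle_add_le hy1 hx1 (by rwa [real_inner_comm])
  · rw [← InnerProductGeometry.angle_smul_right_of_pos _ y hy0]
    exact angle_add_le hx1 hy1 h1

theorem inner_sub_sub_eq_dot (p q r : Pt) : inner ℝ (p - q) (r - q) = dot p q r := by
  simp [PiLp.inner_apply, Fin.sum_univ_two, dot, mul_comm]

theorem IsGood.exists_direction : ∀ {l : List Pt}, IsGood l → ∀ p,
    ∃ d : Pt, d ≠ 0 ∧ ∀ q, (p, q) ∈ edges l → InnerProductGeometry.angle d (q - p) ≤ Real.pi / 4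
  | [], _, p => by
    obtain ⟨d, hd⟩ := exists_ne (0 : Pt)
    exact ⟨d, hd, by simp [edges]⟩
  | [x], _, p => by
    obtain ⟨d, hd⟩ := exists_ne (0 : Pt)
    exact ⟨d, hd, by simp [edges]⟩
  | v :: w :: r, h, p => by
    have hnd := h.nodup
    rw [IsGood] at h
    obtain ⟨hv, -, ha, hg⟩ := h
    have hvw : v ≠ w := by rintro rfl; simp at hv
    have hpi := Real.pi_pos
    by_cases hpv : p = v
    · subst hpv
      refine ⟨w - p, sub_ne_zero.2 hvw.symm, fun q hq => ?_⟩
      rcases mem_edges_cons.1 hq with he | he | he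
      · obtain rfl := (Prod.ext_iff.1 he).2
        rw [InnerProductGeometry.angle_self (sub_ne_zero.2 hvw.symm)]
        positivity
      · exact absurd (Prod.ext_iff.1 he).1 hvw
      · exact absurd (mem_of_mem_edges he).1 hv
    by_cases hpw : p = w
    · subst hpw
      cases r with
      | nil =>
        refine ⟨v - p, sub_ne_zero.2 hvw, fun q hq => ?_⟩
        rcases mem_edges_cons.1 hq with he | he | he
        · exact absurd (Prod.ext_iff.1 he).1 hpv
        · obtain rfl := (Prod.ext_iff.1 he).2
          rw [InnerProductGeometry.angle_self (sub_ne_zero.2 hvw)]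
          positivity
        · simp [edges] at he
      | cons u t =>
        have hup : p ∉ u :: t := (List.nodup_cons.1 (List.nodup_cons.1 hnd).2).1
        have hu : u ≠ p := by rintro rfl; simp at hup
        obtain ⟨d, hd, h1, h2⟩ := exists_angle_le (sub_ne_zero.2 hvw) (sub_ne_zero.2 hu)
          (by rw [inner_sub_sub_eq_dot]; exact ha u (by simp))
        refine ⟨d, hd, fun q hq => ?_⟩
        rcases mem_edges_cons.1 hq with he | he | he
        · exact absurd (Prod.ext_iff.1 he).1 hpv
        · obtain rfl := (Prod.ext_iff.1 he).2
          exact h1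
        · rcases mem_edges_cons.1 he with he | he | he
          · obtain rfl := (Prod.ext_iff.1 he).2
            exact h2
          · exact absurd (Prod.ext_iff.1 he).1.symm hu
          · exact absurd (mem_of_mem_edges he).1 hup
    · obtain ⟨d, hd, h1⟩ := hg.exists_direction p
      refine ⟨d, hd, fun q hq => h1 q ?_⟩
      rcases mem_edges_cons.1 hq with he | he | he
      · exact absurd (Prod.ext_iff.1 he).1 hpv
      · exact absurd (Prod.ext_iff.1 he).1 hpw
      · exact he

theorem IsGood.exists_spanningPath {S : Finset Pt} {p : Pt} {l : List Pt} (h : IsGood (p :: l))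
    (hS : ∀ x, x ∈ p :: l ↔ x ∈ S) :
    ∃ P : PSLG S, P.IsSpanningPath ∧ P.IsPhiOpen (3 * Real.pi / 2) ∧ P.deg p ≤ 1 := by
  have hcard : S.card = (p :: l).length := by
    rw [← List.toFinset_card_of_nodup h.nodup]
    congr 1
    ext x
    rw [List.mem_toFinset, hS]
  refine ⟨⟨edges (p :: l), fun e => swap_mem_edges, fun e he => ?_,
    fun e => ne_of_mem_edges h.nodup, h.noncross⟩, ⟨⟨?_, ?_⟩, ?_⟩, ?_, ?_⟩
  · rw [← hS, ← hS]
    exact mem_of_mem_edges he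
  · intro a ha b hb
    exact reachable_edges a ((hS a).2 ha) b ((hS b).2 hb)
  · rw [hcard]
    exact card_edges h.nodup
  · exact fun q _ => card_filter_le h.nodup q
  · intro q _
    have : Real.pi - 3 * Real.pi / 2 / 2 = Real.pi / 4 := by ring
    rw [VertexOpen, this]
    exact h.exists_direction q
  · exact card_filter_head_le h.nodup

theorem orient_ne_zero {S : Finset Pt} (hgp : GenPos S) {p q r : Pt} (hp : p ∈ S) (hq : q ∈ S)
    (hr : r ∈ S) (hpq : p ≠ q) (hpr : p ≠ r) (hqr : q ≠ r) : orient p q r ≠ 0 := by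
  intro h0
  apply hgp p hp q hq r hr hpq hpr hqr
  rw [collinear_iff_of_mem (p₀ := p) (by simp)]
  refine ⟨q - p, ?_⟩
  have hr' : ∃ t : ℝ, r = t • (q - p) +ᵥ p := by
    unfold orient at h0
    by_cases h : q 0 - p 0 = 0
    · have h1 : q 1 - p 1 ≠ 0 := by
        intro h1
        apply hpq
        ext i
        fin_cases i
        · simp; linarith
        · simp; linarith
      refine ⟨(r 1 - p 1) / (q 1 - p 1), ?_⟩
      ext i
      fin_cases i
      · rw [h, zero_mul, zero_sub, neg_eq_zero, mul_eq_zero, or_iff_right h1] at h0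
        simp [h]
        linarith
      · simp
        field_simp
        ring
    · refine ⟨(r 0 - p 0) / (q 0 - p 0), ?_⟩
      ext i
      fin_cases i
      · simp
        field_simp
        ring
      · simp
        field_simp
        linarith
  simp only [Set.mem_insert_iff, Set.mem_singleton_iff, forall_eq_or_imp, forall_eq]
  exact ⟨⟨0, by simp⟩, ⟨1, by simp⟩, hr'⟩

/-- No point of a set in convex position is inside a triangle of three other points. -/
theorem not_inside {S : Finset Pt} (hcp : ConvexPos S) {p a b c : Pt} (hp : p ∈ S) (ha : a ∈ S)
    (hb : b ∈ S) (hc : c ∈ S) (h1 : 0 < orient p a b) (h2 : 0 < orient p b c)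
    (h3 : 0 < orient p c a) : False := by
  have hself (x y : Pt) : orient x x y = 0 := by unfold orient; ring
  have hmem {x : Pt} (hx : x ∈ S) (hxp : x ≠ p) :
      x ∈ convexHull ℝ (↑(S.erase p) : Set Pt) :=
    subset_convexHull ℝ _ (by simp [hx, hxp])
  have ha' := hmem ha (by rintro rfl; simp [hself] at h1)
  have hb' := hmem hb (by rintro rfl; simp [hself] at h2)
  have hc' := hmem hc (by rintro rfl; simp [hself] at h3)
  apply hcp p hp
  set D := orient p b c + orient p c a + orient p a b with hD
  have hD0 : 0 < D := by positivity
  have hsum : orient p b c / D + orient p c a / D + orient p a b / D = 1 := by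
    rw [← add_div, ← add_div, div_self hD0.ne']
  have hpe : p = (orient p b c / D) • a + (orient p c a / D) • b + (orient p a b / D) • c := by
    ext i
    have hD' := hD0.ne'
    fin_cases i
    · simp
      field_simp
      rw [hD]; unfold orient; ring
    · simp
      field_simp
      rw [hD]; unfold orient; ring
  have hconv := convex_convexHull ℝ (↑(S.erase p) : Set Pt)
  have key := hconv.sum_mem (t := Finset.univ) (w := ![orient p b c / D, orient p c a / D,
    orient p a b / D]) (z := ![a, b, c]) (fun i _ => by fin_cases i <;> simp <;> positivity)
    (by simpa [Fin.sum_univ_three] using hsum) (fun i _ => by fin_cases i <;> assumption)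
  simp only [Fin.sum_univ_three] at key
  convert key using 1
  exact hpe

/-- The other points of a set in convex position, sorted by angle around the point `p`. -/
theorem exists_sorted {S : Finset Pt} (hgp : GenPos S) (hcp : ConvexPos S) {p : Pt}
    (hp : p ∈ S) : ∃ L : List Pt, (p :: L).Nodup ∧ (∀ x, x ∈ p :: L ↔ x ∈ S) ∧
      L.Pairwise fun x y => 0 < orient p x y := by
  let T := {x // x ∈ S.erase p}
  let R : T → T → Prop := fun x y => x = y ∨ 0 < orient p x y
  have hT (x : T) : p ≠ x ∧ (x : Pt) ∈ S :=
    ⟨fun h => (Finset.mem_erase.1 x.2).1 h.symm, Finset.mem_of_mem_erase x.2⟩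
  have htot (x y : T) (h : x ≠ y) : 0 < orient p x y ∨ 0 < orient p y x := by
    have := orient_ne_zero hgp hp (hT x).2 (hT y).2 (hT x).1 (hT y).1
      (fun he => h (Subtype.ext he))
    rw [orient_swap p x y]
    rcases this.lt_or_gt with h | h
    · right; linarith
    · left; exact h
  have : IsTrans T R := ⟨fun x y z hxy hyz => by
    rcases hxy with rfl | hxy
    · exact hyz
    rcases hyz with rfl | hyz
    · exact .inr hxy
    by_cases hxz : x = z
    · exact .inl hxz
    · refine .inr ((htot x z hxz).resolve_right fun hzx => ?_)
      exact not_inside hcp hp (hT x).2 (hT y).2 (hT z).2 hxy hyz hzx⟩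
  have : Std.Antisymm R := ⟨fun x y hxy hyx => by
    rcases hxy with rfl | hxy
    · rfl
    rcases hyx with rfl | hyx
    · rfl
    rw [orient_swap] at hyx
    linarith⟩
  have : Std.Total R := ⟨fun x y => by
    by_cases h : x = y
    · exact .inl (.inl h)
    · exact (htot x y h).imp .inr .inr⟩
  refine ⟨((Finset.univ : Finset T).sort R).map Subtype.val, ?_, fun x => ?_, ?_⟩
  · refine List.nodup_cons.2 ⟨fun h => ?_,
      (Finset.sort_nodup _ _).map Subtype.val_injective⟩
    obtain ⟨x, -, hx⟩ := List.mem_map.1 h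
    exact (hT x).1 hx.symm
  · rw [List.mem_cons, List.mem_map]
    constructor
    · rintro (rfl | ⟨y, -, rfl⟩)
      · exact hp
      · exact (hT y).2
    · intro hx
      by_cases hxp : x = p
      · exact .inl hxp
      · exact .inr ⟨⟨x, Finset.mem_erase.2 ⟨hxp, hx⟩⟩, by simp, rfl⟩
  · rw [List.pairwise_map]
    refine ((Finset.pairwise_sort Finset.univ R).and (Finset.sort_nodup Finset.univ R)).imp ?_
    rintro x y ⟨h, hne⟩
    exact h.resolve_left hne

theorem isCcw_of_sorted {S : Finset Pt} (hgp : GenPos S) (hcp : ConvexPos S) {p : Pt}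
    {L : List Pt} (hnd : (p :: L).Nodup) (hS : ∀ x, x ∈ p :: L ↔ x ∈ S)
    (hL : L.Pairwise fun x y => 0 < orient p x y) :
    IsCcw (fun i => (p :: L).getD i p) (p :: L).length := by
  have hget (i : ℕ) (hi : i < (p :: L).length) : (p :: L).getD i p = (p :: L)[i] := by
    rw [List.getD_eq_getElem]
  have hmem (i : ℕ) (hi : i < (p :: L).length) : (p :: L)[i] ∈ S :=
    (hS _).1 (List.getElem_mem hi)
  have h0 (i j : ℕ) (hi : 0 < i) (hij : i < j) (hj : j < (p :: L).length) :
      0 < orient p (p :: L)[i] (p :: L)[j] := by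
    obtain ⟨i, rfl⟩ : ∃ k, i = k + 1 := ⟨i - 1, by lia⟩
    obtain ⟨j, rfl⟩ : ∃ k, j = k + 1 := ⟨j - 1, by lia⟩
    simpa using List.pairwise_iff_getElem.1 hL i j (by simp at hj; lia) (by simpa using hj)
      (by lia)
  have hne (i j : ℕ) (hi : i < (p :: L).length) (hj : j < (p :: L).length) (hij : i ≠ j) :
      (p :: L)[i] ≠ (p :: L)[j] := fun h => hij ((hnd.getElem_inj_iff).1 h)
  refine ⟨fun i hi j hj h => ?_, fun i j k hij hjk hk => ?_⟩
  · by_contra hij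
    simp only [hget i hi, hget j hj] at h
    exact hne i j hi hj hij h
  · simp only [hget i (by lia), hget j (by lia), hget k hk]
    rcases Nat.eq_zero_or_pos i with rfl | hi
    · exact h0 j k hij hjk hk
    by_contra hn
    have hlt := lt_of_le_of_ne (not_lt.1 hn) (orient_ne_zero hgp (hmem i (by lia))
      (hmem j (by lia)) (hmem k hk) (hne _ _ _ _ (by lia)) (hne _ _ _ _ (by lia))
      (hne _ _ _ _ (by lia)))
    have h1 := h0 i j hi hij (by lia)
    have h2 := h0 j k (by lia) hjk hk
    refine not_inside hcp (hmem j (by lia)) ((hS p).1 (by simp)) (hmem i (by lia)) (hmem k hk)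
      (by rwa [← orient_rotate]) ?_ (by rwa [orient_rotate])
    rw [orient_swap, orient_rotate]
    linarith

end ConvexPath

/-- For a finite point set in convex position (and general position), every point `p ∈ S`
is an endpoint (a vertex of degree at most one) of some `3π/2`-open spanning path. -/
theorem stmt14 (S : Finset Pt) (hgp : GenPos S) (hcp : ConvexPos S)
    (p : Pt) (hp : p ∈ S) :
    ∃ P : PSLG S, P.IsSpanningPath ∧ P.IsPhiOpen (3 * Real.pi / 2) ∧ P.deg p ≤ 1 := by
  obtain ⟨L, hnd, hS, hL⟩ := ConvexPath.exists_sorted hgp hcp hp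
  have hf := ConvexPath.isCcw_of_sorted hgp hcp hnd hS hL
  obtain ⟨l, hl, hmem⟩ := (ConvexPath.exists_paths hf L.length 0 L.length (by lia)
    (by simp) (by lia)).1
  refine ConvexPath.IsGood.exists_spanningPath (p := p)
    (l := l.map fun i => (p :: L).getD i p) (by simpa using hl) fun x => ?_
  have hmap : p :: l.map (fun i => (p :: L).getD i p) =
      (0 :: l).map fun i => (p :: L).getD i p := by simp
  rw [hmap, ← hS, List.mem_map, List.mem_iff_getElem]
  constructor
  · rintro ⟨i, hi, rfl⟩
    have := (hmem i).1 hi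
    have hi' : i < (p :: L).length := by simp; lia
    exact ⟨i, hi', by rw [List.getD_eq_getElem]⟩
  · rintro ⟨i, hi, rfl⟩
    exact ⟨i, (hmem i).2 (by simp at hi; lia), by rw [List.getD_eq_getElem]⟩
end
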